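/- arXiv:2508.01528 — 2 statements merged into one kernel-verified Lean document; each statement's English description precedes it below -/
import Mathlib

section
/- Let Ω ⊂ ℝⁿ be open and bounded with C² boundary, let p > 2, let λ > 0, and let f ∈ C²(cl(Ω)) be nonnegative with f(x) = 0 and Df(x) = 0 for every x ∈ ∂Ω. Let u^ε ∈ C²(Ω) ∩ C(cl(Ω)) be the maximal solution of the state-constraint problem for λu + |Du|^p − εΔu = f (a classical solution in Ω, a viscosity supersolution on cl(Ω), satisfying liminf_{Ω∋x→x₀} (u^ε(x) − u^ε(x₀))/|x−x₀|^{α_p} < 0 for every x₀ ∈ ∂Ω), and let u ∈ C(cl(Ω)) be the state-constraint viscosity solution of λu + |Du|^p = f. Then there exists ε₀ > 0 such that for every ε ∈ (0, ε₀): max_{x ∈ cl(Ω)} (u^ε(x) − u(x)) ≤ (1/λ + 2^{α_p}/α_p)·ε^{1 − α_p/2}. -/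
open Set Metric Filter Topology Bornology MeasureTheory NNReal ENNReal

noncomputable section

/-- Distance to the boundary of `Ω`. -/
def dBdry {n : ℕ} (Ω : Set (EuclideanSpace ℝ (Fin n))) (x : EuclideanSpace ℝ (Fin n)) : ℝ :=
  Metric.infDist x (frontier Ω)

/-- The Laplacian of a real-valued function, as the trace of its second derivative. -/
def lapl {n : ℕ} (φ : EuclideanSpace ℝ (Fin n) → ℝ) (x : EuclideanSpace ℝ (Fin n)) : ℝ :=
  ∑ i : Fin n, fderiv ℝ (fderiv ℝ φ) x (EuclideanSpace.single i 1) (EuclideanSpace.single i 1)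

/-- The constant `δ_Ω`: one third of the supremum of those `δ` (below the inradius) such that
the boundary-distance function is `C²`-smooth on `Ω ∖ Ω_δ = {x ∈ Ω : d_∂Ω(x) ≤ δ}`. -/
def deltaOm {n : ℕ} (Ω : Set (EuclideanSpace ℝ (Fin n))) : ℝ :=
  (1 / 3) * sSup {δ : ℝ | 0 < δ ∧ δ < sSup (dBdry Ω '' Ω) ∧
    ContDiffOn ℝ 2 (dBdry Ω) {x ∈ Ω | dBdry Ω x ≤ δ}}

/-- Oscillation of `f` over `s`: `sup_s f − inf_s f`. -/
def oscOn {n : ℕ} (f : EuclideanSpace ℝ (Fin n) → ℝ) (s : Set (EuclideanSpace ℝ (Fin n))) : ℝ :=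
  sSup (f '' s) - sInf (f '' s)

/-- Viscosity subsolution of `λu + |Du|^p − ε·Δu = w` in `Ω` (with `C²` test functions). -/
def ViscSubIn {n : ℕ} (Ω : Set (EuclideanSpace ℝ (Fin n))) (lam p ε : ℝ)
    (w u : EuclideanSpace ℝ (Fin n) → ℝ) : Prop :=
  ∀ x₀ ∈ Ω, ∀ φ : EuclideanSpace ℝ (Fin n) → ℝ, ContDiff ℝ 2 φ →
    IsLocalMaxOn (fun x => u x - φ x) Ω x₀ →
    lam * u x₀ + ‖gradient φ x₀‖ ^ p - ε * lapl φ x₀ - w x₀ ≤ 0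

/-- Viscosity supersolution of `λv + |Dv|^p − ε·Δv = w` on `closure Ω` (`C²` test functions). -/
def ViscSupOn {n : ℕ} (Ω : Set (EuclideanSpace ℝ (Fin n))) (lam p ε : ℝ)
    (w v : EuclideanSpace ℝ (Fin n) → ℝ) : Prop :=
  ∀ x₀ ∈ closure Ω, ∀ φ : EuclideanSpace ℝ (Fin n) → ℝ, ContDiff ℝ 2 φ →
    IsLocalMinOn (fun x => v x - φ x) (closure Ω) x₀ →
    0 ≤ lam * v x₀ + ‖gradient φ x₀‖ ^ p - ε * lapl φ x₀ - w x₀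

/-- First-order (`ε = 0`) viscosity subsolution of `λu + |Du|^p = w` in `Ω`
(with `C¹` test functions). -/
def ViscSubIn1 {n : ℕ} (Ω : Set (EuclideanSpace ℝ (Fin n))) (lam p : ℝ)
    (w u : EuclideanSpace ℝ (Fin n) → ℝ) : Prop :=
  ∀ x₀ ∈ Ω, ∀ φ : EuclideanSpace ℝ (Fin n) → ℝ, ContDiff ℝ 1 φ →
    IsLocalMaxOn (fun x => u x - φ x) Ω x₀ →
    lam * u x₀ + ‖gradient φ x₀‖ ^ p - w x₀ ≤ 0

/-- First-order (`ε = 0`) viscosity supersolution of `λv + |Dv|^p = w` on `closure Ω`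
(with `C¹` test functions). -/
def ViscSupOn1 {n : ℕ} (Ω : Set (EuclideanSpace ℝ (Fin n))) (lam p : ℝ)
    (w v : EuclideanSpace ℝ (Fin n) → ℝ) : Prop :=
  ∀ x₀ ∈ closure Ω, ∀ φ : EuclideanSpace ℝ (Fin n) → ℝ, ContDiff ℝ 1 φ →
    IsLocalMinOn (fun x => v x - φ x) (closure Ω) x₀ →
    0 ≤ lam * v x₀ + ‖gradient φ x₀‖ ^ p - w x₀

/-- Classical (`C²`) solution of `λu + |Du|^p − ε·Δu = w` in the open set `Ω`. -/
def ClassicalSolIn {n : ℕ} (Ω : Set (EuclideanSpace ℝ (Fin n))) (lam p ε : ℝ)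
    (w u : EuclideanSpace ℝ (Fin n) → ℝ) : Prop :=
  ContDiffOn ℝ 2 u Ω ∧
    ∀ x ∈ Ω, lam * u x + ‖gradient u x‖ ^ p - ε * lapl u x = w x

/-- The boundary condition `liminf_{Ω ∋ x → x₀} (u(x) − u(x₀))/|x − x₀|^α < 0` at every
boundary point `x₀`. -/
def BdryStrict {n : ℕ} (Ω : Set (EuclideanSpace ℝ (Fin n))) (α : ℝ)
    (u : EuclideanSpace ℝ (Fin n) → ℝ) : Prop :=
  ∀ x₀ ∈ frontier Ω,
    Filter.liminf (fun x => (u x - u x₀) / ‖x - x₀‖ ^ α) (𝓝[Ω] x₀) < 0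

/-- `g` is semiconcave (with linear modulus) on `s` with semiconcavity constant `K`. -/
def SemicOn {n : ℕ} (g : EuclideanSpace ℝ (Fin n) → ℝ)
    (s : Set (EuclideanSpace ℝ (Fin n))) (K : ℝ) : Prop :=
  ∀ x y : EuclideanSpace ℝ (Fin n), segment ℝ x y ⊆ s → ∀ t ∈ Icc (0:ℝ) 1,
    t * g x + (1 - t) * g y - g (t • x + (1 - t) • y) ≤ t * (1 - t) * (K * ‖x - y‖ ^ 2 / 2)


/-- Second order Taylor expansion with Peano remainder. -/
lemma taylor2 {E : Type*} [NormedAddCommGroup E] [NormedSpace ℝ E] {w : E → ℝ} {x0 : E}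
    (hw : ContDiffAt ℝ 2 w x0) (κ : ℝ) (hκ : 0 < κ) :
    ∀ᶠ v in 𝓝 (0 : E), |w (x0 + v) - w x0 - fderiv ℝ w x0 v
      - (1 / 2) * fderiv ℝ (fderiv ℝ w) x0 v v| ≤ κ * ‖v‖ ^ 2 := by
  have h1 : ContDiffAt ℝ 1 (fderiv ℝ w) x0 := hw.fderiv_right (by norm_num)
  have hA : HasFDerivAt (fderiv ℝ w) (fderiv ℝ (fderiv ℝ w) x0) x0 :=
    (h1.differentiableAt (by norm_num)).hasFDerivAt
  set A := fderiv ℝ (fderiv ℝ w) x0 with hAdef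
  have hsymm : ∀ u v, A u v = A v u := fun u v =>
    (hw.isSymmSndFDerivAt (by simp)).eq u v
  have hev : ∀ᶠ y in 𝓝 x0, DifferentiableAt ℝ w y := by
    have := hw.eventually (by simp)
    filter_upwards [this] with y hy
    exact hy.differentiableAt (by norm_num)
  have hlo := hA.isLittleO.def hκ
  rw [← map_add_left_nhds_zero] at hev hlo
  obtain ⟨ρ, hρ, hball⟩ := (Metric.eventually_nhds_iff_ball.1 (Filter.eventually_map.1 (hev.and hlo)))
  filter_upwards [Metric.ball_mem_nhds (0 : E) hρ] with v hv
  let R : E → ℝ := fun z => w (x0 + z) - fderiv ℝ w x0 z - (1 / 2) * A z z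
  have hR : ∀ z ∈ Metric.closedBall (0 : E) ‖v‖,
      HasFDerivWithinAt R (fderiv ℝ w (x0 + z) - fderiv ℝ w x0 - A z)
        (Metric.closedBall (0 : E) ‖v‖) z := by
    intro z hz
    have hz' : z ∈ Metric.ball (0 : E) ρ := by
      simp at hz hv ⊢; linarith
    have d1 : HasFDerivAt (fun z => w (x0 + z)) (fderiv ℝ w (x0 + z)) z := by
      have := (hball z hz').1.hasFDerivAt
      have h2 : HasFDerivAt (fun z : E => x0 + z) (ContinuousLinearMap.id ℝ E) z :=
        (hasFDerivAt_id z).const_add x0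
      have h3 := HasFDerivAt.comp z this h2
      rw [ContinuousLinearMap.comp_id] at h3
      exact h3
    have d2 : HasFDerivAt (fun z => fderiv ℝ w x0 z) (fderiv ℝ w x0) z :=
      (fderiv ℝ w x0).hasFDerivAt
    have d3 : HasFDerivAt (fun z => A z z) (A z + A.flip z) z := by
      have := A.hasFDerivAt (x := z) |>.clm_apply (hasFDerivAt_id z)
      refine this.congr_fderiv ?_
      ext u
      simp
    have := ((d1.sub d2).sub (d3.const_mul (1 / 2))).hasFDerivWithinAt
      (s := Metric.closedBall (0 : E) ‖v‖)
    refine this.congr_fderiv ?_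
    ext u
    simp [hsymm u z]
    ring
  have hb : ∀ z ∈ Metric.closedBall (0 : E) ‖v‖,
      ‖fderiv ℝ w (x0 + z) - fderiv ℝ w x0 - A z‖ ≤ κ * ‖v‖ := by
    intro z hz
    have hz' : z ∈ Metric.ball (0 : E) ρ := by
      simp at hz hv ⊢; linarith
    have := (hball z hz').2
    simp at this hz
    refine this.trans ?_
    gcongr
  have := (convex_closedBall (0 : E) ‖v‖).norm_image_sub_le_of_norm_hasFDerivWithin_le hR hb
    (x := 0) (y := v) (by simp) (by simp)
  simp only [R, add_zero, map_zero, sub_zero, Real.norm_eq_abs, mul_zero] at this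
  calc _ = _ := by congr 1; ring
    _ ≤ _ := this
    _ = _ := by ring

/-- A continuous function with locally controlled second differences. -/
lemma second_diff_1d (g : ℝ → ℝ) (hg : Continuous g) (C : ℝ)
    (h : ∀ t0 : ℝ, ∀ κ > 0, ∀ᶠ s in 𝓝 (0 : ℝ), g (t0 + s) + g (t0 - s) - 2 * g t0 ≤ (C + κ) * s ^ 2) :
    g 1 + g (-1) - 2 * g 0 ≤ C := by
  by_contra hcon
  push Not at hcon
  obtain ⟨κ, hκ, hκ2⟩ : ∃ κ > 0, C + κ < g 1 + g (-1) - 2 * g 0 :=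
    ⟨(g 1 + g (-1) - 2 * g 0 - C) / 2, by linarith, by linarith⟩
  set b := (g 1 - g (-1)) / 2
  set c := (g 1 + g (-1)) / 2 - (C + κ) / 2
  let G : ℝ → ℝ := fun t => g t - (C + κ) / 2 * t ^ 2 - b * t - c
  have hGc : Continuous G := by fun_prop
  obtain ⟨t0, ht0, hmin⟩ := (isCompact_Icc (a := (-1 : ℝ)) (b := 1)).exists_isMinOn
    ⟨0, by simp⟩ hGc.continuousOn
  have hG1 : G 1 = 0 := by simp only [G, b, c]; ring
  have hGm1 : G (-1) = 0 := by simp only [G, b, c]; ring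
  have hG0 : G 0 < 0 := by simp only [G, c]; linarith
  have hlt : G t0 < 0 := (hmin (by simp : (0 : ℝ) ∈ Icc (-1 : ℝ) 1)).trans_lt hG0
  have hne1 : t0 ≠ 1 := by rintro rfl; linarith
  have hnem1 : t0 ≠ -1 := by rintro rfl; linarith
  have hint : t0 ∈ Ioo (-1 : ℝ) 1 := ⟨lt_of_le_of_ne ht0.1 (Ne.symm hnem1), lt_of_le_of_ne ht0.2 hne1⟩
  have e1 := h t0 (κ / 2) (by linarith)
  have e2 : ∀ᶠ s in 𝓝 (0 : ℝ), t0 + s ∈ Ioo (-1 : ℝ) 1 := by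
    have : ContinuousAt (fun s : ℝ => t0 + s) 0 := by fun_prop
    exact this (by simpa using isOpen_Ioo.mem_nhds hint)
  have e3 : ∀ᶠ s in 𝓝 (0 : ℝ), t0 - s ∈ Ioo (-1 : ℝ) 1 := by
    have : ContinuousAt (fun s : ℝ => t0 - s) 0 := by fun_prop
    exact this (by simpa using isOpen_Ioo.mem_nhds hint)
  have e4 : ∀ᶠ s in 𝓝[>] (0 : ℝ), 0 < s := eventually_mem_nhdsWithin
  obtain ⟨s, ⟨⟨h1, h2⟩, h3⟩, hs⟩ := ((((e1.and e2).and e3).filter_mono nhdsWithin_le_nhds).and e4).exists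
  have m1 := hmin (Ioo_subset_Icc_self h2)
  have m2 := hmin (Ioo_subset_Icc_self h3)
  simp only [G, mem_ofPred_eq] at m1 m2
  have : 0 < κ * s ^ 2 := by positivity
  nlinarith

section Abstract
variable {E : Type*} [NormedAddCommGroup E] [InnerProductSpace ℝ E] [ProperSpace E]

/-- Lipschitz bound for the first order solution on the whole space. -/
lemma lip_of_sub (U F : E → ℝ) (lam p L B : ℝ) (hlam : 0 < lam) (hU : Continuous U)
    (hU0 : ∀ x, 0 ≤ U x) (hUB : ∀ x, U x ≤ B) (hL : 0 < L)
    (hLF : ∀ x, F x < L ^ p)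
    (hsub : ∀ (x ξ : E) (C : ℝ), (∀ᶠ v in 𝓝 (0 : E), U (x + v) ≤ U x + inner ℝ ξ v + C * ‖v‖ ^ 2) →
      lam * U x + ‖ξ‖ ^ p ≤ F x) (x y : E) : U x ≤ U y + L * ‖x - y‖ := by
  have hB : 0 ≤ B := (hU0 0).trans (hUB 0)
  have hR : 0 ≤ B / L := by positivity
  obtain ⟨z, hz, hmax⟩ := (isCompact_closedBall y (B / L)).exists_isMaxOn
    ⟨y, by simpa using hR⟩ (f := fun x => U x - L * ‖x - y‖) (by fun_prop)
  have hglob : ∀ x, U x - L * ‖x - y‖ ≤ U z - L * ‖z - y‖ := by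
    intro x
    by_cases hx : x ∈ Metric.closedBall y (B / L)
    · exact hmax hx
    · have h1 : U y - L * ‖y - y‖ ≤ U z - L * ‖z - y‖ := hmax (by simpa using hR)
      simp only [Metric.mem_closedBall, dist_eq_norm, not_le] at hx
      have : B < L * ‖x - y‖ := by rw [div_lt_iff₀ hL] at hx; linarith
      simp at h1
      linarith [hUB x, hU0 y]
  by_cases hzy : z = y
  · subst hzy
    have := hglob x
    simp at this
    linarith
  · exfalso
    set a := ‖z - y‖ with ha
    have hapos : 0 < a := norm_pos_iff.2 (sub_ne_zero.2 hzy)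
    have := hsub z ((L / a) • (z - y)) (L / (2 * a)) (by
      refine Eventually.of_forall fun v => ?_
      have h1 := hglob (z + v)
      have h2 : ‖z + v - y‖ ^ 2 = a ^ 2 + 2 * inner ℝ (z - y) v + ‖v‖ ^ 2 := by
        rw [show z + v - y = (z - y) + v by abel, norm_add_sq_real]
      have h3 : ‖z + v - y‖ ≤ (‖z + v - y‖ ^ 2 + a ^ 2) / (2 * a) := by
        rw [le_div_iff₀ (by positivity)]
        nlinarith [sq_nonneg (‖z + v - y‖ - a)]
      rw [h2] at h3
      rw [real_inner_smul_left]
      have h4 : L * ((a ^ 2 + 2 * inner ℝ (z - y) v + ‖v‖ ^ 2 + a ^ 2) / (2 * a)) =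
        L * a + L / a * inner ℝ (z - y) v + L / (2 * a) * ‖v‖ ^ 2 := by
        field_simp
        ring
      have := mul_le_mul_of_nonneg_left h3 hL.le
      linarith)
    rw [norm_smul, Real.norm_eq_abs, abs_of_pos (by positivity), ← ha, div_mul_cancel₀ _ hapos.ne'] at this
    have h0 := mul_nonneg hlam.le (hU0 z)
    linarith [hLF z]

/-- Semiconcavity of the first order solution on the whole space. -/
lemma semiconc_of_visc (U F : E → ℝ) (lam p K B R : ℝ) (hlam : 0 < lam) (hp : 1 ≤ p) (hU : Continuous U)
    (hF : UniformContinuous F)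
    (hU0 : ∀ x, 0 ≤ U x) (hUB : ∀ x, U x ≤ B) (hK : 0 ≤ K)
    (hsupp : ∀ x, R < ‖x‖ → U x = 0)
    (hsub : ∀ (x ξ : E) (C : ℝ), (∀ᶠ v in 𝓝 (0 : E), U (x + v) ≤ U x + inner ℝ ξ v + C * ‖v‖ ^ 2) →
      lam * U x + ‖ξ‖ ^ p ≤ F x)
    (hsup : ∀ (x ξ : E) (C : ℝ), (∀ᶠ v in 𝓝 (0 : E), U x + inner ℝ ξ v - C * ‖v‖ ^ 2 ≤ U (x + v)) →
      F x ≤ lam * U x + ‖ξ‖ ^ p)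
    (hFK : ∀ x h, F (x + h) + F (x - h) - 2 * F x ≤ K * ‖h‖ ^ 2) (x h : E) :
    U (x + h) + U (x - h) - 2 * U x ≤ K / lam * ‖h‖ ^ 2 := by
  have hB : 0 ≤ B := (hU0 0).trans (hUB 0)
  by_contra hcon
  push Not at hcon
  set m := U (x + h) + U (x - h) - 2 * U x with hm
  have hm0 : 0 < m := lt_of_le_of_lt (by positivity) hcon
  -- modulus
  set τ := (lam * m - K * ‖h‖ ^ 2) / 4 with hτ
  have hτ0 : 0 < τ := by
    have : K * ‖h‖ ^ 2 < lam * m := by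
      have := mul_lt_mul_of_pos_left hcon hlam
      calc K * ‖h‖ ^ 2 = lam * (K / lam * ‖h‖ ^ 2) := by field_simp
        _ < _ := this
    rw [hτ]; linarith
  obtain ⟨ρ, hρ, hmod⟩ := Metric.uniformContinuous_iff.1 hF τ hτ0
  -- penalization parameter
  obtain ⟨k, hk, hk2⟩ : ∃ k : ℝ, 0 < k ∧ 2 * B < k * ρ ^ 2 := by
    refine ⟨(2 * B + 1) / ρ ^ 2, by positivity, ?_⟩
    rw [div_mul_cancel₀ _ (by positivity)]; linarith
  let Φ : E × E × E → ℝ := fun q =>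
    U (q.1 + h + q.2.1) + U (q.1 - h + q.2.2) - 2 * U q.1 - k * ‖q.2.1‖ ^ 2 - k * ‖q.2.2‖ ^ 2
  have hΦc : Continuous Φ := by fun_prop
  have hst : ∀ c s t : E, 0 ≤ Φ (c, s, t) → ‖s‖ < ρ ∧ ‖t‖ < ρ := by
    intro c s t hpos
    simp only [Φ] at hpos
    have i1 := hUB (c + h + s)
    have i2 := hUB (c - h + t)
    have i3 := hU0 c
    have i4 : 0 ≤ k * ‖s‖ ^ 2 := by positivity
    have i5 : 0 ≤ k * ‖t‖ ^ 2 := by positivity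
    constructor
    · by_contra hh
      push Not at hh
      have : k * ρ ^ 2 ≤ k * ‖s‖ ^ 2 := by gcongr
      linarith
    · by_contra hh
      push Not at hh
      have : k * ρ ^ 2 ≤ k * ‖t‖ ^ 2 := by gcongr
      linarith
  have hc : ∀ c s t : E, 0 < Φ (c, s, t) → ‖c‖ ≤ R + ‖h‖ + ρ := by
    intro c s t hpos
    obtain ⟨hs, ht⟩ := hst c s t hpos.le
    by_contra hh
    push Not at hh
    have n1 : R < ‖c + h + s‖ := by
      have h1 : ‖c‖ ≤ ‖c + h + s‖ + ‖h‖ + ‖s‖ := by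
        calc ‖c‖ = ‖(c + h + s) - h - s‖ := by congr 1; abel
          _ ≤ ‖(c + h + s) - h‖ + ‖s‖ := norm_sub_le _ _
          _ ≤ _ := by gcongr; exact norm_sub_le _ _
      linarith
    have n2 : R < ‖c - h + t‖ := by
      have h1 : ‖c‖ ≤ ‖c - h + t‖ + ‖h‖ + ‖t‖ := by
        calc ‖c‖ = ‖(c - h + t) + h - t‖ := by congr 1; abel
          _ ≤ ‖(c - h + t) + h‖ + ‖t‖ := norm_sub_le _ _
          _ ≤ _ := by gcongr; exact norm_add_le _ _
      linarith
    simp only [Φ] at hpos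
    rw [hsupp _ n1, hsupp _ n2] at hpos
    have i3 := hU0 c
    have i4 : 0 ≤ k * ‖s‖ ^ 2 := by positivity
    have i5 : 0 ≤ k * ‖t‖ ^ 2 := by positivity
    linarith
  have hΦx : Φ (x, 0, 0) = m := by simp [Φ, hm]
  set Q : Set (E × E × E) := Metric.closedBall (0 : E) (R + ‖h‖ + ρ) ×ˢ
    (Metric.closedBall (0 : E) ρ ×ˢ Metric.closedBall (0 : E) ρ) with hQ
  have hQc : IsCompact Q := (isCompact_closedBall _ _).prod
    ((isCompact_closedBall _ _).prod (isCompact_closedBall _ _))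
  have hmemQ : ∀ c s t : E, 0 < Φ (c, s, t) → (c, s, t) ∈ Q := by
    intro c s t hpos
    have := hst c s t hpos.le
    have := hc c s t hpos
    simp [hQ]
    refine ⟨by assumption, ?_, ?_⟩ <;> linarith
  have hxQ := hmemQ x 0 0 (by rw [hΦx]; exact hm0)
  obtain ⟨⟨c, s, t⟩, hcst, hmax⟩ := hQc.exists_isMaxOn ⟨_, hxQ⟩ hΦc.continuousOn
  have hge : m ≤ Φ (c, s, t) := by rw [← hΦx]; exact hmax hxQ
  have hglob : ∀ c' s' t' : E, Φ (c', s', t') ≤ Φ (c, s, t) := by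
    intro c' s' t'
    by_cases hpos : 0 < Φ (c', s', t')
    · exact hmax (hmemQ _ _ _ hpos)
    · linarith
  obtain ⟨hs, ht⟩ := hst c s t (hm0.le.trans hge)
  have T1 := hsub (c + h + s) ((2 * k) • s) k (Eventually.of_forall fun v => by
    have := hglob c (s + v) t
    simp only [Φ] at this
    rw [norm_add_sq_real, ← add_assoc] at this
    rw [real_inner_smul_left]
    nlinarith)
  have T2 := hsub (c - h + t) ((2 * k) • t) k (Eventually.of_forall fun v => by
    have := hglob c s (t + v)
    simp only [Φ] at this
    rw [norm_add_sq_real, ← add_assoc] at this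
    rw [real_inner_smul_left]
    nlinarith)
  have T3 := hsup c (k • (s + t)) k (Eventually.of_forall fun v => by
    have := hglob (c + v) (s - v) (t - v)
    simp only [Φ] at this
    rw [norm_sub_sq_real, norm_sub_sq_real, show c + v + h + (s - v) = c + h + s by abel,
      show c + v - h + (t - v) = c - h + t by abel] at this
    rw [real_inner_smul_left, inner_add_left]
    nlinarith)
  have hconv : ‖k • (s + t)‖ ^ p ≤ (‖(2 * k) • s‖ ^ p + ‖(2 * k) • t‖ ^ p) / 2 := by
    have h1 : ‖k • (s + t)‖ ≤ (1 / 2) * ‖(2 * k) • s‖ + (1 / 2) * ‖(2 * k) • t‖ := by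
      simp only [norm_smul, Real.norm_eq_abs, abs_of_pos hk, abs_of_pos (show 0 < 2 * k by positivity)]
      nlinarith [norm_add_le s t]
    have h2 := (convexOn_rpow hp).2 (mem_Ici.2 (norm_nonneg ((2 * k) • s)))
      (mem_Ici.2 (norm_nonneg ((2 * k) • t))) (by norm_num : (0 : ℝ) ≤ 1 / 2)
      (by norm_num : (0 : ℝ) ≤ 1 / 2) (by norm_num)
    simp only [smul_eq_mul] at h2
    have h3 := Real.rpow_le_rpow (norm_nonneg _) h1 (by linarith : 0 ≤ p)
    linarith
  have f1 := hmod (a := c + h + s) (b := c + h) (by simpa [dist_eq_norm] using hs)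
  have f2 := hmod (a := c - h + t) (b := c - h) (by simpa [dist_eq_norm] using ht)
  rw [Real.dist_eq, abs_lt] at f1 f2
  have f3 := hFK c h
  have hval : m ≤ U (c + h + s) + U (c - h + t) - 2 * U c := by
    simp only [Φ] at hge
    have i4 : 0 ≤ k * ‖s‖ ^ 2 := by positivity
    have i5 : 0 ≤ k * ‖t‖ ^ 2 := by positivity
    linarith
  have := mul_le_mul_of_nonneg_left hval hlam.le
  linarith [f1.1, f1.2, f2.1, f2.2]

end Abstract

section DataPart
variable {E : Type*} [NormedAddCommGroup E] [NormedSpace ℝ E] [FiniteDimensional ℝ E]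

/-- The second derivative of a function of class `C²` on the compact closure is bounded. -/
lemma bdd_second (Ω : Set E) (hΩo : IsOpen Ω) (hΩb : IsBounded Ω) (f : E → ℝ)
    (hf : ContDiffOn ℝ 2 f (closure Ω)) :
    ∃ K : ℝ, 0 ≤ K ∧ ∀ x ∈ Ω, ∀ v, fderiv ℝ (fderiv ℝ f) x v v ≤ K * ‖v‖ ^ 2 := by
  have hcomp : IsCompact (closure Ω) := hΩb.isCompact_closure
  have key : ∃ K : ℝ, ∀ x ∈ closure Ω, x ∈ Ω → ‖iteratedFDeriv ℝ 2 f x‖ ≤ K := by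
    refine hcomp.induction_on (p := fun s => ∃ K : ℝ, ∀ x ∈ s, x ∈ Ω → ‖iteratedFDeriv ℝ 2 f x‖ ≤ K)
      ⟨0, by simp⟩ ?_ ?_ ?_
    · rintro s t hst ⟨K, hK⟩
      exact ⟨K, fun x hx => hK x (hst hx)⟩
    · rintro s t ⟨K, hK⟩ ⟨K', hK'⟩
      refine ⟨max K K', fun x hx hxΩ => ?_⟩
      rcases hx with hx | hx
      · exact (hK x hx hxΩ).trans (le_max_left _ _)
      · exact (hK' x hx hxΩ).trans (le_max_right _ _)
    · intro b hb
      have h1 : ContDiffWithinAt ℝ ((2 : ℕ) : WithTop ℕ∞) f (closure Ω) b := hf b hb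
      rw [contDiffWithinAt_nat] at h1
      obtain ⟨u, hu, P, hP⟩ := h1
      rw [insert_eq_of_mem hb] at hu
      have hbu : b ∈ u := mem_of_mem_nhdsWithin hb hu
      have hc := (hP.cont 2 (by norm_num)) b hbu
      have hbd : ∀ᶠ x in 𝓝[u] b, ‖P x 2‖ < ‖P b 2‖ + 1 :=
        (hc.norm).eventually_lt_const (by linarith)
      have hbd' : ∀ᶠ x in 𝓝[closure Ω] b, ‖P x 2‖ < ‖P b 2‖ + 1 := by
        rw [eventually_iff, mem_nhdsWithin] at hbd
        obtain ⟨V, hVo, hbV, hV⟩ := hbd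
        filter_upwards [hu, mem_nhdsWithin_of_mem_nhds (hVo.mem_nhds hbV)] with x h1 h2
        exact hV ⟨h2, h1⟩
      obtain ⟨V, hVo, hbV, hV⟩ := mem_nhdsWithin.1 hu
      refine ⟨_, hbd'.and (mem_nhdsWithin_of_mem_nhds (hVo.mem_nhds hbV)), ‖P b 2‖ + 1, ?_⟩
      rintro x ⟨hx1, hx2⟩ hxΩ
      have hopen : IsOpen (V ∩ Ω) := hVo.inter hΩo
      have hP' := hP.mono (show V ∩ Ω ⊆ u from fun y hy => hV ⟨hy.1, subset_closure hy.2⟩)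
      have h3 := hP'.eq_iteratedFDerivWithin_of_uniqueDiffOn (m := 2) (by norm_num)
        hopen.uniqueDiffOn ⟨hx2, hxΩ⟩
      rw [iteratedFDerivWithin_of_isOpen 2 hopen ⟨hx2, hxΩ⟩] at h3
      rw [← h3]
      exact le_of_lt hx1
  obtain ⟨K, hK⟩ := key
  refine ⟨max K 0, le_max_right _ _, fun x hx v => ?_⟩
  have h1 := hK x (subset_closure hx) hx
  have h2 := (iteratedFDeriv ℝ 2 f x).le_opNorm ![v, v]
  rw [iteratedFDeriv_two_apply] at h2
  simp [Fin.prod_univ_two] at h2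
  have h3 : ‖iteratedFDeriv ℝ 2 f x‖ * (‖v‖ * ‖v‖) ≤ max K 0 * (‖v‖ * ‖v‖) := by
    gcongr; exact h1.trans (le_max_left _ _)
  calc _ ≤ |fderiv ℝ (fderiv ℝ f) x v v| := le_abs_self _
    _ ≤ _ := h2
    _ ≤ _ := h3
    _ = _ := by ring

/-- Quadratic growth from the boundary. -/
lemma data_quad (Ω : Set E) (hΩo : IsOpen Ω) (hne : Ω ≠ univ) (f : E → ℝ)
    (hf : ContDiffOn ℝ 2 f (closure Ω)) (hf0 : ∀ x ∈ frontier Ω, f x = 0)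
    (hDf : ∀ x ∈ frontier Ω, fderivWithin ℝ f (closure Ω) x = 0)
    (K : ℝ) (hK : ∀ x ∈ Ω, ∀ v, fderiv ℝ (fderiv ℝ f) x v v ≤ K * ‖v‖ ^ 2) :
    ∀ y ∈ Ω, f y ≤ K / 2 * (Metric.infDist y Ωᶜ) ^ 2 := by
  intro y hy
  obtain ⟨b, hb, hbd⟩ := exists_mem_frontier_infDist_compl_eq_dist hy hne
  set e := y - b with he
  have hbcl : b ∈ closure Ω := hb.1
  have hbΩ : b ∉ Ω := by
    rw [hΩo.frontier_eq] at hb; exact hb.2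
  have hyb : 0 < dist y b := dist_pos.2 (fun h => hbΩ (h ▸ hy))
  have hseg : ∀ s ∈ Ioc (0 : ℝ) 1, b + s • e ∈ Ω := by
    intro s hs
    apply Metric.ball_infDist_compl_subset (x := y)
    rw [hbd, mem_ball, dist_eq_norm, dist_eq_norm,
      show b + s • e - y = -((1 - s) • (y - b)) by rw [he]; module, norm_neg, norm_smul,
      Real.norm_eq_abs, abs_of_nonneg (by linarith [hs.2])]
    rw [dist_eq_norm] at hyb
    nlinarith [hs.1]
  have hsegc : ∀ s ∈ Icc (0 : ℝ) 1, b + s • e ∈ closure Ω := by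
    intro s hs
    rcases eq_or_lt_of_le hs.1 with h | h
    · rw [← h]; simpa using hbcl
    · exact subset_closure (hseg s ⟨h, hs.2⟩)
  have hline : ∀ s : ℝ, HasDerivAt (fun s : ℝ => b + s • e) e s := by
    intro s
    simpa using ((hasDerivAt_id s).smul_const e).const_add b
  let γ : ℝ → ℝ := fun s => f (b + s • e)
  have hγ : ContDiffOn ℝ 2 γ (Icc 0 1) := by
    refine hf.comp (t := closure Ω) (g := f) (f := fun s : ℝ => b + s • e) ?_ hsegc
    fun_prop
  have huniq := uniqueDiffOn_Icc (zero_lt_one (α := ℝ))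
  have hγ1 : ContDiffOn ℝ 1 (derivWithin γ (Icc 0 1)) (Icc 0 1) :=
    hγ.derivWithin huniq (by norm_num)
  have h0 : derivWithin γ (Icc 0 1) 0 = 0 := by
    have h1 : HasFDerivWithinAt f (fderivWithin ℝ f (closure Ω) b) (closure Ω) b :=
      ((hf b hbcl).differentiableWithinAt (by norm_num)).hasFDerivWithinAt
    rw [hDf b hb] at h1
    have h2 : HasFDerivWithinAt f (0 : E →L[ℝ] ℝ) (closure Ω) (b + (0 : ℝ) • e) := by simpa using h1
    have h3 := h2.comp_hasDerivWithinAt (0 : ℝ) ((hline 0).hasDerivWithinAt (s := Icc 0 1)) hsegc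
    have := h3.derivWithin (huniq 0 (by simp))
    simpa [γ, Function.comp_def] using this
  have hC2 : ∀ x ∈ Ω, ContDiffAt ℝ 2 f x := fun x hx =>
    (hf.mono subset_closure).contDiffAt (hΩo.mem_nhds hx)
  have hd1 : ∀ s ∈ Ioo (0 : ℝ) 1, HasDerivAt γ (fderiv ℝ f (b + s • e) e) s := by
    intro s hs
    exact ((hC2 _ (hseg s ⟨hs.1, hs.2.le⟩)).differentiableAt (by norm_num)).hasFDerivAt.comp_hasDerivAt s
      (hline s)
  have heq : ∀ s ∈ Ioo (0 : ℝ) 1, derivWithin γ (Icc 0 1) s = fderiv ℝ f (b + s • e) e := by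
    intro s hs
    rw [derivWithin_of_mem_nhds (Icc_mem_nhds hs.1 hs.2), (hd1 s hs).deriv]
  have hd2 : ∀ s ∈ Ioo (0 : ℝ) 1, HasDerivAt (derivWithin γ (Icc 0 1))
      (fderiv ℝ (fderiv ℝ f) (b + s • e) e e) s := by
    intro s hs
    have h1 : HasFDerivAt (fderiv ℝ f) (fderiv ℝ (fderiv ℝ f) (b + s • e)) (b + s • e) :=
      (((hC2 _ (hseg s ⟨hs.1, hs.2.le⟩)).fderiv_right (m := 1) (by norm_num)).differentiableAt
        (by norm_num)).hasFDerivAt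
    have h2 := h1.comp_hasDerivAt s (hline s)
    have h3 := h2.clm_apply (hasDerivAt_const s e)
    simp only [map_zero, add_zero] at h3
    refine h3.congr_of_eventuallyEq ?_
    filter_upwards [isOpen_Ioo.mem_nhds hs] with t ht
    exact heq t ht
  set C := K * ‖e‖ ^ 2 with hCdef
  have hb1 : ∀ s ∈ Icc (0 : ℝ) 1, derivWithin γ (Icc 0 1) s ≤ C * s := by
    intro s hs
    have := (convex_Icc (0 : ℝ) 1).image_sub_le_mul_sub_of_deriv_le (f := derivWithin γ (Icc 0 1))
      (C := C) hγ1.continuousOn (by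
        rw [interior_Icc]
        intro t ht
        exact (hd2 t ht).differentiableAt.differentiableWithinAt) (by
        rw [interior_Icc]
        intro t ht
        rw [(hd2 t ht).deriv]
        exact hK _ (hseg t ⟨ht.1, ht.2.le⟩) e) 0 (by simp) s hs hs.1
    rw [h0] at this
    linarith
  have hanti : AntitoneOn (fun s => γ s - C / 2 * s ^ 2) (Icc 0 1) := by
    refine antitoneOn_of_deriv_nonpos (convex_Icc _ _) ?_ ?_ ?_
    · exact hγ.continuousOn.sub (by fun_prop)
    · rw [interior_Icc]
      intro t ht
      exact ((hd1 t ht).differentiableAt.sub (by fun_prop)).differentiableWithinAt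
    · rw [interior_Icc]
      intro t ht
      have h1 : HasDerivAt (fun s : ℝ => C / 2 * s ^ 2) (C / 2 * (2 * t)) t := by
        simpa using (hasDerivAt_pow 2 t).const_mul (C / 2)
      have h2 := (hd1 t ht).sub h1
      have h3 : deriv (fun s => γ s - C / 2 * s ^ 2) t = _ := h2.deriv
      rw [h3, ← heq t ht]
      have := hb1 t ⟨ht.1.le, ht.2.le⟩
      linarith
  have hfin := hanti (a := 0) (b := 1) (by simp) (by simp) zero_le_one
  simp only [γ, he, one_smul, zero_smul, add_zero, hf0 b hb] at hfin
  rw [hbd, dist_eq_norm]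
  rw [show b + (y - b) = y by abel] at hfin
  rw [hCdef, he] at hfin
  linarith

/-- Semiconcavity of the extension by zero of the data. -/
lemma data_semiconc (Ω : Set E) (hΩo : IsOpen Ω) (hΩb : IsBounded Ω) (hne : Ω ≠ univ) (f : E → ℝ)
    (hf : ContDiffOn ℝ 2 f (closure Ω)) (hf0 : ∀ x ∈ frontier Ω, f x = 0)
    (hDf : ∀ x ∈ frontier Ω, fderivWithin ℝ f (closure Ω) x = 0) :
    ∃ K : ℝ, 0 ≤ K ∧ (∀ x h, Ω.indicator f (x + h) + Ω.indicator f (x - h) - 2 * Ω.indicator f x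
      ≤ K * ‖h‖ ^ 2) ∧ ∀ y ∈ Ω, f y ≤ K * (Metric.infDist y Ωᶜ) ^ 2 := by
  obtain ⟨K, hK0, hK⟩ := bdd_second Ω hΩo hΩb f hf
  have hq := data_quad Ω hΩo hne f hf hf0 hDf K hK
  refine ⟨K, hK0, ?_, fun y hy => (hq y hy).trans (by gcongr; linarith)⟩
  intro x h
  have hFc : Continuous (Ω.indicator f) := continuous_indicator hf0 hf.continuousOn
  have main := second_diff_1d (fun t => Ω.indicator f (x + t • h)) (by fun_prop) (K * ‖h‖ ^ 2) ?_
  · simpa [sub_eq_add_neg] using main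
  intro t0 κ hκ
  set z := x + t0 • h with hz
  have e1 : ∀ s : ℝ, x + (t0 + s) • h = z + s • h := fun s => by rw [hz]; module
  have e2 : ∀ s : ℝ, x + (t0 - s) • h = z + -(s • h) := fun s => by rw [hz]; module
  simp only [e1, e2]
  by_cases hzΩ : z ∈ Ω
  · have hC2 : ContDiffAt ℝ 2 f z := (hf.mono subset_closure).contDiffAt (hΩo.mem_nhds hzΩ)
    have hκ' : 0 < κ / (2 * (‖h‖ ^ 2 + 1)) := by positivity
    have hT := taylor2 hC2 _ hκ'
    have hΩn : ∀ᶠ v in 𝓝 (0 : E), z + v ∈ Ω := by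
      have : ContinuousAt (fun v : E => z + v) 0 := by fun_prop
      exact this (by simpa using hΩo.mem_nhds hzΩ)
    have l1 : Tendsto (fun s : ℝ => s • h) (𝓝 0) (𝓝 0) := by
      have : ContinuousAt (fun s : ℝ => s • h) 0 := by fun_prop
      simpa [ContinuousAt] using this
    have l2 : Tendsto (fun s : ℝ => -(s • h)) (𝓝 0) (𝓝 0) := by simpa using l1.neg
    filter_upwards [l1.eventually (hT.and hΩn), l2.eventually (hT.and hΩn)] with s hs1 hs2
    rw [indicator_of_mem hs1.2, indicator_of_mem hs2.2, indicator_of_mem hzΩ]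
    have a1 := (abs_le.1 hs1.1).2
    have a2 := (abs_le.1 hs2.1).2
    have a3 := hK z hzΩ (s • h)
    simp only [map_neg, neg_apply, norm_neg, neg_neg] at a1 a2
    have n1 : ‖s • h‖ ^ 2 = s ^ 2 * ‖h‖ ^ 2 := by
      rw [norm_smul, mul_pow, Real.norm_eq_abs, sq_abs]
    rw [n1] at a1 a2 a3
    have a4 : κ / (2 * (‖h‖ ^ 2 + 1)) * (s ^ 2 * ‖h‖ ^ 2) ≤ κ / 2 * s ^ 2 := by
      rw [div_mul_eq_mul_div, div_le_iff₀ (by positivity)]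
      nlinarith [mul_nonneg hκ.le (sq_nonneg s)]
    linarith
  · refine Eventually.of_forall fun s => ?_
    have hv : ∀ v, Ω.indicator f (z + v) ≤ K / 2 * ‖v‖ ^ 2 := by
      intro v
      by_cases hzv : z + v ∈ Ω
      · rw [indicator_of_mem hzv]
        refine (hq _ hzv).trans ?_
        have : Metric.infDist (z + v) Ωᶜ ≤ ‖v‖ := by
          refine (Metric.infDist_le_dist_of_mem (y := z) hzΩ).trans ?_
          simp [dist_eq_norm]
        have h0 : 0 ≤ Metric.infDist (z + v) Ωᶜ := Metric.infDist_nonneg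
        gcongr
      · rw [indicator_of_notMem hzv]; positivity
    rw [indicator_of_notMem hzΩ]
    have a1 := hv (s • h)
    have a2 := hv (-(s • h))
    have n1 : ‖s • h‖ ^ 2 = s ^ 2 * ‖h‖ ^ 2 := by
      rw [norm_smul, mul_pow, Real.norm_eq_abs, sq_abs]
    rw [norm_neg] at a2
    rw [n1] at a1 a2
    have : 0 ≤ κ * s ^ 2 := by positivity
    nlinarith

end DataPart

section DistPart
variable {E : Type*} [NormedAddCommGroup E] [InnerProductSpace ℝ E] [FiniteDimensional ℝ E]

lemma dist_ascend (Ω : Set E) (hΩo : IsOpen Ω) (hne : Ω ≠ univ) (z : E) (hz : z ∈ Ω)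
    (hd : DifferentiableAt ℝ (fun x => Metric.infDist x Ωᶜ) z) (θ : ℝ) (hθ : 0 < θ) :
    ∃ ν : E, ‖ν‖ = 1 ∧ ∀ᶠ t in 𝓝[>] (0 : ℝ),
      Metric.infDist z Ωᶜ + (1 - θ) * t < Metric.infDist (z + t • ν) Ωᶜ := by
  obtain ⟨b, hb, hbd⟩ := exists_mem_frontier_infDist_compl_eq_dist hz hne
  have hbΩ : b ∉ Ω := by
    rw [hΩo.frontier_eq] at hb; exact hb.2
  have hzb : 0 < ‖z - b‖ := norm_pos_iff.2 (sub_ne_zero.2 (fun h => hbΩ (h ▸ hz)))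
  rw [dist_eq_norm] at hbd
  refine ⟨(‖z - b‖)⁻¹ • (z - b), ?_, ?_⟩
  · rw [norm_smul, norm_inv, norm_norm, inv_mul_cancel₀ hzb.ne']
  set ν := (‖z - b‖)⁻¹ • (z - b) with hν
  set φ : ℝ → ℝ := fun t => Metric.infDist (z + t • ν) Ωᶜ with hφ
  have hline : HasDerivAt (fun s : ℝ => z + s • ν) ν 0 := by
    simpa using ((hasDerivAt_id (0 : ℝ)).smul_const ν).const_add z
  have hder : HasDerivAt φ (fderiv ℝ (fun x => Metric.infDist x Ωᶜ) z ν) 0 := by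
    have h1 : HasFDerivAt (fun x => Metric.infDist x Ωᶜ)
      (fderiv ℝ (fun x => Metric.infDist x Ωᶜ) z) (z + (0 : ℝ) • ν) := by simpa using hd.hasFDerivAt
    exact h1.comp_hasDerivAt (0 : ℝ) hline
  set a := fderiv ℝ (fun x => Metric.infDist x Ωᶜ) z ν
  have hsl := hasDerivAt_iff_tendsto_slope.1 hder
  have hφ0 : φ 0 = ‖z - b‖ := by simp [hφ, hbd]
  have hneg : ∀ t ∈ Ioo (-‖z - b‖) 0, 1 ≤ slope φ 0 t := by
    intro t ht
    have h1 : φ t ≤ ‖z - b‖ + t := by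
      refine (Metric.infDist_le_dist_of_mem (y := b) hbΩ).trans ?_
      rw [dist_eq_norm, show z + t • ν - b = (1 + t * (‖z - b‖)⁻¹) • (z - b) by rw [hν]; module,
        norm_smul, Real.norm_eq_abs, abs_of_nonneg]
      · rw [add_mul, mul_assoc, inv_mul_cancel₀ hzb.ne']; linarith
      · have : -1 ≤ t * (‖z - b‖)⁻¹ := by
          rw [← div_eq_mul_inv, le_div_iff₀ hzb]; linarith [ht.1]
        linarith
    rw [slope_def_field, sub_zero, le_div_iff_of_neg ht.2, hφ0]
    linarith
  have ha : 1 ≤ a := by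
    have hsl' : Tendsto (slope φ 0) (𝓝[<] 0) (𝓝 a) :=
      hsl.mono_left (nhdsWithin_mono _ (fun x hx => ne_of_lt hx))
    refine ge_of_tendsto hsl' ?_
    filter_upwards [Ioo_mem_nhdsLT (show -‖z - b‖ < 0 by linarith)] with t ht using hneg t ht
  have hsl' : Tendsto (slope φ 0) (𝓝[>] 0) (𝓝 a) :=
    hsl.mono_left (nhdsWithin_mono _ (fun x hx => ne_of_gt hx))
  have h2 := hsl'.eventually_const_lt (show 1 - θ < a by linarith)
  filter_upwards [h2, self_mem_nhdsWithin] with t ht ht0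
  rw [slope_def_field, sub_zero, lt_div_iff₀ ht0, hφ0] at ht
  rw [hbd]
  simp only [hφ] at ht
  linarith

/-- Uniform interior ball condition, in quadratic form. -/
lemma int_ball (Ω : Set E) (hΩo : IsOpen Ω) (hne : Ω ≠ univ) (δ : ℝ) (hδ : 0 < δ)
    (hd : ∀ z ∈ Ω, Metric.infDist z Ωᶜ < 2 * δ →
      DifferentiableAt ℝ (fun x => Metric.infDist x Ωᶜ) z)
    (x0 : E) (hx0 : x0 ∈ Ω) (hxδ : Metric.infDist x0 Ωᶜ ≤ δ) :
    ∃ e : E, ‖e‖ = 1 ∧ ∀ v, Metric.infDist x0 Ωᶜ + inner ℝ e v - ‖v‖ ^ 2 / (2 * δ) ≤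
      Metric.infDist (x0 + v) Ωᶜ := by
  set D : E → ℝ := fun x => Metric.infDist x Ωᶜ with hD
  have hDc : Continuous D := Metric.continuous_infDist_pt _
  have hnonempty : (Ωᶜ).Nonempty := nonempty_compl.2 hne
  have hpos : ∀ x, 0 < D x → x ∈ Ω := by
    intro x hx
    by_contra hxn
    have : D x = 0 := Metric.infDist_zero_of_mem hxn
    linarith
  have hDpos : ∀ x ∈ Ω, 0 < D x := by
    intro x hx
    exact (hΩo.isClosed_compl.notMem_iff_infDist_pos hnonempty).1 (by simpa using hx)
  have hlip : ∀ x y, D x ≤ D y + ‖x - y‖ := by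
    intro x y
    rw [← dist_eq_norm]
    exact Metric.infDist_le_infDist_add_dist
  have hSc : IsCompact (Metric.sphere x0 δ) := isCompact_sphere x0 δ
  have stepθ : ∀ θ > 0, θ < 1 → ∃ z ∈ Metric.sphere x0 δ, D x0 + (1 - θ) * δ ≤ D z := by
    intro θ hθ hθ1
    obtain ⟨z, hz, hmax⟩ := (isCompact_closedBall x0 δ).exists_isMaxOn ⟨x0, by simp [hδ.le]⟩
      (f := fun x => D x - (1 - θ) * ‖x - x0‖) (by fun_prop)
    have h0 : D x0 - (1 - θ) * ‖x0 - x0‖ ≤ D z - (1 - θ) * ‖z - x0‖ := hmax (by simp [hδ.le])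
    simp only [sub_self, norm_zero, mul_zero, sub_zero] at h0
    have hzn : ‖z - x0‖ ≤ δ := by simpa [dist_eq_norm] using hz
    rcases eq_or_lt_of_le hzn with heq | hlt
    · refine ⟨z, by simpa [dist_eq_norm] using heq, ?_⟩
      rw [heq] at h0; linarith
    · exfalso
      have hzΩ : z ∈ Ω := hpos z (by
        have := hDpos x0 hx0
        have : 0 ≤ (1 - θ) * ‖z - x0‖ := mul_nonneg (by linarith) (norm_nonneg _)
        linarith)
      have hz2 : D z < 2 * δ := by
        have := hlip z x0
        have hh : D x0 ≤ δ := hxδ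
        linarith
      obtain ⟨ν, hν, hev⟩ := dist_ascend Ω hΩo hne z hzΩ (hd z hzΩ hz2) θ hθ
      have hev2 : ∀ᶠ t in 𝓝[>] (0 : ℝ), t < δ - ‖z - x0‖ :=
        nhdsWithin_le_nhds (Iio_mem_nhds (show (0 : ℝ) < δ - ‖z - x0‖ by linarith))
      obtain ⟨t, ⟨ht1, ht2⟩, ht0⟩ := ((hev.and hev2).and self_mem_nhdsWithin).exists
      have ht0' : 0 < t := ht0
      have hn : ‖z + t • ν - x0‖ ≤ ‖z - x0‖ + t := by
        calc _ = ‖(z - x0) + t • ν‖ := by congr 1; abel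
          _ ≤ ‖z - x0‖ + ‖t • ν‖ := norm_add_le _ _
          _ = _ := by rw [norm_smul, hν, Real.norm_eq_abs, abs_of_pos ht0', mul_one]
      have h3 : D (z + t • ν) - (1 - θ) * ‖z + t • ν - x0‖ ≤ D z - (1 - θ) * ‖z - x0‖ :=
        hmax (by
          rw [Metric.mem_closedBall, dist_eq_norm]
          linarith)
      have h4 := mul_le_mul_of_nonneg_left hn (show 0 ≤ 1 - θ by linarith)
      change D z + (1 - θ) * t < D (z + t • ν) at ht1
      linarith
  obtain ⟨z1, hz1, -⟩ := stepθ (1 / 2) (by norm_num) (by norm_num)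
  obtain ⟨z, hz, hmax⟩ := hSc.exists_isMaxOn ⟨z1, hz1⟩ hDc.continuousOn
  have hDz : D x0 + δ ≤ D z := by
    refine le_of_forall_pos_lt_add ?_
    intro κ hκ
    have hθ : 0 < min (1 / 2) (κ / (2 * δ)) := by positivity
    obtain ⟨z', hz', hDz'⟩ := stepθ (min (1 / 2) (κ / (2 * δ))) hθ
      (lt_of_le_of_lt (min_le_left _ _) (by norm_num))
    have h1 : D z' ≤ D z := hmax hz'
    have h2 : min (1 / 2) (κ / (2 * δ)) * δ ≤ κ / (2 * δ) * δ := by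
      gcongr; exact min_le_right _ _
    have h3 : κ / (2 * δ) * δ = κ / 2 := by field_simp
    linarith
  have hzn : ‖z - x0‖ = δ := by simpa [dist_eq_norm] using hz
  refine ⟨δ⁻¹ • (z - x0), ?_, ?_⟩
  · rw [norm_smul, hzn, norm_inv, Real.norm_eq_abs, abs_of_pos hδ, inv_mul_cancel₀ hδ.ne']
  intro v
  have h1 := hlip z (x0 + v)
  have h2 : ‖z - (x0 + v)‖ ^ 2 = δ ^ 2 - 2 * inner ℝ (z - x0) v + ‖v‖ ^ 2 := by
    rw [← sub_sub, norm_sub_sq_real, hzn]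
  have h3 : ‖z - (x0 + v)‖ ≤ (‖z - (x0 + v)‖ ^ 2 + δ ^ 2) / (2 * δ) := by
    rw [le_div_iff₀ (by positivity)]
    nlinarith [sq_nonneg (‖z - (x0 + v)‖ - δ)]
  rw [h2] at h3
  have h4 : (δ ^ 2 - 2 * inner ℝ (z - x0) v + ‖v‖ ^ 2 + δ ^ 2) / (2 * δ) =
    δ - δ⁻¹ * inner ℝ (z - x0) v + ‖v‖ ^ 2 / (2 * δ) := by
    field_simp; ring
  rw [real_inner_smul_left]
  change D x0 + _ - _ ≤ D (x0 + v)
  linarith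

end DistPart

lemma dBdry_eq {n : ℕ} (Ω : Set (EuclideanSpace ℝ (Fin n))) (hΩo : IsOpen Ω) (hne : Ω ≠ univ)
    (x : EuclideanSpace ℝ (Fin n)) (hx : x ∈ Ω) : dBdry Ω x = Metric.infDist x Ωᶜ := by
  obtain ⟨b, hb, hbd⟩ := exists_mem_frontier_infDist_compl_eq_dist hx hne
  apply le_antisymm
  · rw [hbd]; exact Metric.infDist_le_dist_of_mem hb
  · apply Metric.infDist_le_infDist_of_subset _ ⟨b, hb⟩
    rw [hΩo.frontier_eq]
    exact fun y hy => hy.2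

/-- The `C²` hypothesis gives differentiability of the distance near the boundary. -/
lemma dist_diff {n : ℕ} (Ω : Set (EuclideanSpace ℝ (Fin n))) (hΩo : IsOpen Ω)
    (hC2 : 0 < deltaOm Ω) : Ω ≠ univ ∧ ∃ δ > 0, ∀ z ∈ Ω, Metric.infDist z Ωᶜ < 2 * δ →
      DifferentiableAt ℝ (fun x => Metric.infDist x Ωᶜ) z := by
  have hnon : {δ : ℝ | 0 < δ ∧ δ < sSup (dBdry Ω '' Ω) ∧
    ContDiffOn ℝ 2 (dBdry Ω) {x ∈ Ω | dBdry Ω x ≤ δ}}.Nonempty := by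
    by_contra h
    rw [not_nonempty_iff_eq_empty] at h
    rw [deltaOm, h] at hC2
    simp at hC2
  obtain ⟨δ, hδ, hδ2, hcd⟩ := hnon
  have hne : Ω ≠ univ := by
    rintro rfl
    have : ∀ x, dBdry (univ : Set (EuclideanSpace ℝ (Fin n))) x = 0 := by
      intro x; simp [dBdry]
    have h2 : dBdry (univ : Set (EuclideanSpace ℝ (Fin n))) '' univ = {0} := by
      ext y
      simp only [image_univ, mem_range, this, mem_singleton_iff]
      exact ⟨fun ⟨_, h⟩ => h.symm, fun h => ⟨0, h.symm⟩⟩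
    rw [h2, csSup_singleton] at hδ2
    linarith
  refine ⟨hne, δ / 2, by linarith, fun z hz hzδ => ?_⟩
  have hopen : IsOpen {x ∈ Ω | Metric.infDist x Ωᶜ < δ} :=
    hΩo.inter (isOpen_lt (Metric.continuous_infDist_pt _) continuous_const)
  have hsub : {x ∈ Ω | Metric.infDist x Ωᶜ < δ} ⊆ {x ∈ Ω | dBdry Ω x ≤ δ} := by
    rintro x ⟨hx, hxδ⟩
    refine ⟨hx, ?_⟩
    rw [dBdry_eq Ω hΩo hne x hx]; exact hxδ.le
  have hmem : {x ∈ Ω | Metric.infDist x Ωᶜ < δ} ∈ 𝓝 z := hopen.mem_nhds ⟨hz, by linarith⟩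
  have h1 := ((hcd.mono hsub).contDiffAt hmem).differentiableAt (by norm_num)
  refine h1.congr_of_eventuallyEq ?_
  filter_upwards [hmem] with x hx
  exact (dBdry_eq Ω hΩo hne x hx.1).symm

section QuadTest
variable {E : Type*} [NormedAddCommGroup E] [InnerProductSpace ℝ E]

lemma quad_contDiff (x0 ξ : E) (C : ℝ) (k : WithTop ℕ∞) :
    ContDiff ℝ k (fun x : E => inner ℝ ξ (x - x0) + C * ‖x - x0‖ ^ 2) := by
  have h1 : ContDiff ℝ k (fun x : E => x - x0) := contDiff_id.sub contDiff_const
  exact (contDiff_const.inner ℝ h1).add (contDiff_const.mul (h1.norm_sq ℝ))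

lemma quad_gradient [CompleteSpace E] (x0 ξ : E) (C : ℝ) :
    gradient (fun x : E => inner ℝ ξ (x - x0) + C * ‖x - x0‖ ^ 2) x0 = ξ := by
  apply HasGradientAt.gradient
  rw [hasGradientAt_iff_hasFDerivAt]
  have h1 : HasFDerivAt (fun x : E => x - x0) (ContinuousLinearMap.id ℝ E) x0 :=
    (hasFDerivAt_id x0).sub_const x0
  have h2 : HasFDerivAt (fun x : E => inner ℝ ξ (x - x0)) (innerSL ℝ ξ) x0 := by
    have h0 : HasFDerivAt (fun y : E => inner ℝ ξ y) (innerSL ℝ ξ) ((fun x : E => x - x0) x0) :=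
      (innerSL ℝ ξ).hasFDerivAt
    have := HasFDerivAt.comp (f := fun x : E => x - x0) x0 h0 h1
    rw [ContinuousLinearMap.comp_id] at this
    exact this
  have h3 : HasFDerivAt (fun x : E => C * ‖x - x0‖ ^ 2) (0 : E →L[ℝ] ℝ) x0 := by
    have := (h1.norm_sq).const_mul C
    refine this.congr_fderiv ?_
    ext v
    simp
  refine (h2.add h3).congr_fderiv ?_
  ext v
  simp

/-- A paraboloid touching a nonnegative function from above at a zero is flat. -/
lemma xi_zero (ξ : E) (C : ℝ) (h : ∀ᶠ v in 𝓝 (0 : E), 0 ≤ inner ℝ ξ v + C * ‖v‖ ^ 2) : ξ = 0 := by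
  by_contra hne
  have hpos : 0 < ‖ξ‖ ^ 2 := by have := norm_pos_iff.2 hne; positivity
  have l1 : Tendsto (fun t : ℝ => -(t • ξ)) (𝓝[>] 0) (𝓝 0) := by
    have : ContinuousAt (fun s : ℝ => -(s • ξ)) 0 := by fun_prop
    have h2 : Tendsto (fun s : ℝ => -(s • ξ)) (𝓝 0) (𝓝 0) := by simpa [ContinuousAt] using this
    exact h2.mono_left nhdsWithin_le_nhds
  have l2 : ∀ᶠ t in 𝓝[>] (0 : ℝ), t * |C| < 1 := by
    have : ContinuousAt (fun t : ℝ => t * |C|) 0 := by fun_prop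
    have h2 := this.eventually_lt_const (u := 1) (by simp)
    exact h2.filter_mono nhdsWithin_le_nhds
  obtain ⟨t, ⟨h1, h2⟩, h3⟩ := (((l1.eventually h).and l2).and self_mem_nhdsWithin).exists
  have h3' : 0 < t := h3
  rw [inner_neg_right, real_inner_smul_right, real_inner_self_eq_norm_sq, norm_neg, norm_smul,
    mul_pow, Real.norm_eq_abs, sq_abs] at h1
  have h4 : C * (t ^ 2 * ‖ξ‖ ^ 2) ≤ |C| * (t ^ 2 * ‖ξ‖ ^ 2) := by
    gcongr; exact le_abs_self C
  have h5 : 0 < t * ‖ξ‖ ^ 2 := by positivity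
  nlinarith

/-- Consequences of touching a semiconcave solution from below by a (quasi) quadratic. -/
lemma touch_below (U F : E → ℝ) (lam p K : ℝ)
    (hsc : ∀ x h, U (x + h) + U (x - h) - 2 * U x ≤ K * ‖h‖ ^ 2)
    (hsub : ∀ (x ξ : E) (C : ℝ), (∀ᶠ v in 𝓝 (0 : E), U (x + v) ≤ U x + inner ℝ ξ v + C * ‖v‖ ^ 2) →
      lam * U x + ‖ξ‖ ^ p ≤ F x)
    (hsup : ∀ (x ξ : E) (C : ℝ), (∀ᶠ v in 𝓝 (0 : E), U x + inner ℝ ξ v - C * ‖v‖ ^ 2 ≤ U (x + v)) →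
      F x ≤ lam * U x + ‖ξ‖ ^ p)
    (x0 ξ : E) (B : E → ℝ) (hB2 : ∀ (t : ℝ) v, B (t • v) = t ^ 2 * B v) (M : ℝ)
    (hBM : ∀ v, |B v| ≤ M * ‖v‖ ^ 2)
    (h : ∀ κ > 0, ∀ᶠ v in 𝓝 (0 : E),
      U x0 + inner ℝ ξ v + (1 / 2) * B v - κ * ‖v‖ ^ 2 ≤ U (x0 + v)) :
    lam * U x0 + ‖ξ‖ ^ p = F x0 ∧ ∀ v, B v ≤ K * ‖v‖ ^ 2 := by
  have hneg : Tendsto (fun v : E => -v) (𝓝 0) (𝓝 0) := by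
    simpa using (continuous_neg (G := E)).tendsto 0
  have hBn : ∀ v, B (-v) = B v := fun v => by
    have := hB2 (-1) v
    simpa using this
  refine ⟨le_antisymm ?_ ?_, ?_⟩
  · refine hsub x0 ξ (K + M / 2 + 1) ?_
    filter_upwards [hneg.eventually (h 1 one_pos)] with v hv
    have := hsc x0 v
    rw [inner_neg_right, norm_neg, show x0 + -v = x0 - v from (sub_eq_add_neg _ _).symm, hBn] at hv
    have := (abs_le.1 (hBM v)).1
    nlinarith
  · refine hsup x0 ξ (M / 2 + 1) ?_
    filter_upwards [h 1 one_pos] with v hv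
    have := (abs_le.1 (hBM v)).1
    nlinarith
  · intro v
    refine le_of_forall_pos_le_add ?_
    intro κ hκ
    have hκ' : 0 < κ / (2 * (‖v‖ ^ 2 + 1)) := by positivity
    have e1 := h _ hκ'
    have e2 := hneg.eventually e1
    have l1 : Tendsto (fun t : ℝ => t • v) (𝓝[>] 0) (𝓝 0) := by
      have : ContinuousAt (fun s : ℝ => s • v) 0 := by fun_prop
      have h2 : Tendsto (fun s : ℝ => s • v) (𝓝 0) (𝓝 0) := by simpa [ContinuousAt] using this
      exact h2.mono_left nhdsWithin_le_nhds
    obtain ⟨t, h1, h3⟩ := ((l1.eventually (e1.and e2)).and self_mem_nhdsWithin).exists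
    have ht : 0 < t := h3
    obtain ⟨h1, h2⟩ := h1
    have h4 := hsc x0 (t • v)
    rw [inner_neg_right, norm_neg, hBn, show x0 + -(t • v) = x0 - t • v from (sub_eq_add_neg _ _).symm] at h2
    have n1 : ‖t • v‖ ^ 2 = t ^ 2 * ‖v‖ ^ 2 := by
      rw [norm_smul, mul_pow, Real.norm_eq_abs, sq_abs]
    rw [hB2, n1] at h1 h2
    rw [n1] at h4
    have a4 : κ / (2 * (‖v‖ ^ 2 + 1)) * (t ^ 2 * ‖v‖ ^ 2) ≤ κ / 2 * t ^ 2 := by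
      rw [div_mul_eq_mul_div, div_le_iff₀ (by positivity)]
      nlinarith [mul_nonneg hκ.le (sq_nonneg t)]
    have h5 : t ^ 2 * B v ≤ t ^ 2 * (K * ‖v‖ ^ 2 + κ) := by linarith
    exact le_of_mul_le_mul_left h5 (by positivity)

end QuadTest

section Extension
variable {n : ℕ}

lemma u_nonneg (Ω : Set (EuclideanSpace ℝ (Fin n))) (hΩb : IsBounded Ω)
    (p lam : ℝ) (hp : 2 < p) (hlam : 0 < lam) (f u : EuclideanSpace ℝ (Fin n) → ℝ)
    (hf_nonneg : ∀ x ∈ closure Ω, 0 ≤ f x) (hu_cont : ContinuousOn u (closure Ω))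
    (hu_sup : ViscSupOn1 Ω lam p f u) : ∀ x ∈ closure Ω, 0 ≤ u x := by
  intro x hx
  obtain ⟨z, hz, hmin⟩ := hΩb.isCompact_closure.exists_isMinOn ⟨x, hx⟩ hu_cont
  have h1 := hu_sup z hz (fun _ => 0) contDiff_const (by
    have : IsMinOn (fun x => u x - (fun _ => (0 : ℝ)) x) (closure Ω) z := by simpa using hmin
    exact this.localize)
  have hg : gradient (fun _ : EuclideanSpace ℝ (Fin n) => (0 : ℝ)) z = 0 := by
    simp
  rw [hg, norm_zero, Real.zero_rpow (by linarith)] at h1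
  have h2 := hf_nonneg z hz
  have h3 : 0 ≤ u z := by
    by_contra hneg
    push Not at hneg
    nlinarith
  exact h3.trans (hmin hx)

lemma u_le (Ω : Set (EuclideanSpace ℝ (Fin n))) (hΩo : IsOpen Ω) (hΩb : IsBounded Ω)
    (p lam : ℝ) (hlam : 0 < lam) (f u : EuclideanSpace ℝ (Fin n) → ℝ)
    (hf : ContinuousOn f (closure Ω)) (hu_cont : ContinuousOn u (closure Ω))
    (hu_sub : ViscSubIn1 Ω lam p f u) : ∀ x ∈ Ω, lam * u x ≤ f x := by
  intro x0 hx0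
  by_contra hcon
  push Not at hcon
  obtain ⟨z, hz, hmaxu⟩ := hΩb.isCompact_closure.exists_isMaxOn ⟨x0, subset_closure hx0⟩ hu_cont
  have hfx : ContinuousAt f x0 := (hf.mono subset_closure).continuousAt (hΩo.mem_nhds hx0)
  have hev : ∀ᶠ x in 𝓝 x0, x ∈ Ω ∧ f x < lam * u x0 :=
    (hΩo.eventually_mem hx0).and (hfx.eventually_lt_const hcon)
  obtain ⟨ρ, hρ, hball⟩ := Metric.nhds_basis_closedBall.eventually_iff.1 hev
  obtain ⟨k, hk, hkρ⟩ : ∃ k : ℝ, 0 < k ∧ u z - u x0 < k * ρ ^ 2 := by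
    have h0 : u x0 ≤ u z := hmaxu (subset_closure hx0)
    refine ⟨(u z - u x0 + 1) / ρ ^ 2, by apply div_pos; linarith; positivity, ?_⟩
    rw [div_mul_cancel₀ _ (by positivity)]; linarith
  obtain ⟨x1, hx1, hmax⟩ := (isCompact_closedBall x0 ρ).exists_isMaxOn ⟨x0, by simp [hρ.le]⟩
    (f := fun x => u x - (inner ℝ (0 : EuclideanSpace ℝ (Fin n)) (x - x0) + k * ‖x - x0‖ ^ 2)) (by
      refine (hu_cont.mono fun x hx => subset_closure (hball hx).1).sub ?_
      exact (quad_contDiff x0 0 k 1).continuous.continuousOn)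
  have h0 := hmax (show x0 ∈ Metric.closedBall x0 ρ by simp [hρ.le])
  simp at h0
  have hx1Ω : x1 ∈ Ω := (hball hx1).1
  have h2 : u x1 ≤ u z := hmaxu (subset_closure hx1Ω)
  have hlt : dist x1 x0 < ρ := by
    rw [dist_eq_norm]
    by_contra hh
    push Not at hh
    have : k * ρ ^ 2 ≤ k * ‖x1 - x0‖ ^ 2 := by gcongr
    linarith
  have hv := hu_sub x1 hx1Ω _ (quad_contDiff x0 0 k 1) (by
    have h3 : ∀ᶠ x in 𝓝 x1, x ∈ Metric.closedBall x0 ρ := by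
      filter_upwards [Metric.isOpen_ball.mem_nhds (show x1 ∈ Metric.ball x0 ρ from hlt)] with x hx
      exact Metric.ball_subset_closedBall hx
    have h4 : ∀ᶠ x in 𝓝[Ω] x1, x ∈ Metric.closedBall x0 ρ := h3.filter_mono nhdsWithin_le_nhds
    filter_upwards [h4] with x hx
    exact hmax hx)
  have h5 := (hball hx1).2
  have h6 : 0 ≤ ‖gradient (fun x => inner ℝ (0 : EuclideanSpace ℝ (Fin n)) (x - x0) + k * ‖x - x0‖ ^ 2) x1‖ ^ p := by
    positivity
  have h7 : u x0 ≤ u x1 := by nlinarith [sq_nonneg ‖x1 - x0‖]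
  nlinarith

lemma ext_sub (Ω : Set (EuclideanSpace ℝ (Fin n))) (hΩo : IsOpen Ω)
    (p lam : ℝ) (hp : 2 < p) (f u : EuclideanSpace ℝ (Fin n) → ℝ)
    (hu0 : ∀ x ∈ closure Ω, 0 ≤ u x)
    (hu_sub : ViscSubIn1 Ω lam p f u) :
    ∀ (x ξ : EuclideanSpace ℝ (Fin n)) (C : ℝ), (∀ᶠ v in 𝓝 (0 : EuclideanSpace ℝ (Fin n)),
      Ω.indicator u (x + v) ≤ Ω.indicator u x + inner ℝ ξ v + C * ‖v‖ ^ 2) →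
      lam * Ω.indicator u x + ‖ξ‖ ^ p ≤ Ω.indicator f x := by
  intro x ξ C h
  by_cases hx : x ∈ Ω
  · rw [indicator_of_mem hx, indicator_of_mem hx]
    have hv := hu_sub x hx _ (quad_contDiff x ξ C 1) (by
      have h2 : Tendsto (fun y => y - x) (𝓝 x) (𝓝 0) := by
        have : ContinuousAt (fun y => y - x) x := by fun_prop
        simpa [ContinuousAt] using this
      have h3 := (h2.eventually h).filter_mono (nhdsWithin_le_nhds (s := Ω))
      filter_upwards [h3, self_mem_nhdsWithin] with y hy hyΩ
      rw [show x + (y - x) = y by abel, indicator_of_mem hyΩ, indicator_of_mem hx] at hy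
      simp
      linarith)
    rw [quad_gradient] at hv
    linarith
  · rw [indicator_of_notMem hx] at h ⊢
    rw [indicator_of_notMem hx]
    have : ξ = 0 := by
      apply xi_zero ξ C
      filter_upwards [h] with v hv
      have : 0 ≤ Ω.indicator u (x + v) := indicator_nonneg (fun y hy => hu0 y (subset_closure hy)) _
      linarith
    rw [this, norm_zero, Real.zero_rpow (by linarith)]
    simp

lemma ext_sup (Ω : Set (EuclideanSpace ℝ (Fin n))) (hΩo : IsOpen Ω)
    (p lam : ℝ) (f u : EuclideanSpace ℝ (Fin n) → ℝ)
    (hu_sup : ViscSupOn1 Ω lam p f u) :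
    ∀ (x ξ : EuclideanSpace ℝ (Fin n)) (C : ℝ), (∀ᶠ v in 𝓝 (0 : EuclideanSpace ℝ (Fin n)),
      Ω.indicator u x + inner ℝ ξ v - C * ‖v‖ ^ 2 ≤ Ω.indicator u (x + v)) →
      Ω.indicator f x ≤ lam * Ω.indicator u x + ‖ξ‖ ^ p := by
  intro x ξ C h
  by_cases hx : x ∈ Ω
  · rw [indicator_of_mem hx, indicator_of_mem hx]
    have hv := hu_sup x (subset_closure hx) _ (quad_contDiff x ξ (-C) 1) (by
      have h2 : Tendsto (fun y => y - x) (𝓝 x) (𝓝 0) := by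
        have : ContinuousAt (fun y => y - x) x := by fun_prop
        simpa [ContinuousAt] using this
      have h3 := ((h2.eventually h).and (hΩo.mem_nhds hx)).filter_mono
        (nhdsWithin_le_nhds (s := closure Ω))
      filter_upwards [h3] with y hy
      obtain ⟨hy, hyΩ⟩ := hy
      have hyΩ' : y ∈ Ω := hyΩ
      rw [show x + (y - x) = y by abel, indicator_of_mem hyΩ', indicator_of_mem hx] at hy
      simp
      linarith)
    rw [quad_gradient] at hv
    linarith
  · rw [indicator_of_notMem hx, indicator_of_notMem hx]
    have := Real.rpow_nonneg (norm_nonneg ξ) p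
    linarith

end Extension

/-- The boundary layer profile. -/
def Hx (q y : ℝ) : ℝ :=
  2 ^ (1 - q) / (1 - q) - y ^ (1 - q) / (1 - q) - 2 ^ (-q - 2) * (4 - y ^ 2)

/-- Minus the derivative of the profile. -/
def gx (q y : ℝ) : ℝ := y ^ (-q) - 2 ^ (-q - 1) * y

/-- The second derivative of the profile. -/
def H2 (q y : ℝ) : ℝ := q * y ^ (-q - 1) + 2 ^ (-q - 1)

lemma Hx_cont (q : ℝ) (hq1 : q < 1) : Continuous (Hx q) := by
  unfold Hx
  have : Continuous fun y : ℝ => y ^ (1 - q) :=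
    Real.continuous_rpow_const (by linarith)
  fun_prop

lemma Hx_deriv (q y : ℝ) (hq1 : q < 1) (hy : 0 < y) : HasDerivAt (Hx q) (-gx q y) y := by
  unfold Hx
  have h1 := (Real.hasDerivAt_rpow_const (x := y) (p := 1 - q) (Or.inl hy.ne')).div_const (1 - q)
  have h2 : HasDerivAt (fun y : ℝ => (2 : ℝ) ^ (-q - 2) * (4 - y ^ 2)) (2 ^ (-q - 2) * (-(2 * y))) y := by
    have := ((hasDerivAt_pow 2 y).const_sub 4).const_mul ((2 : ℝ) ^ (-q - 2))
    simpa using this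
  have h3 := (h1.const_sub (2 ^ (1 - q) / (1 - q))).sub h2
  refine h3.congr_deriv ?_
  unfold gx
  have e1 : (2 : ℝ) ^ (-q - 1) = 2 ^ (-q - 2) * 2 := by
    rw [show -q - 1 = (-q - 2) + 1 by ring, Real.rpow_add_one (by norm_num)]
  have e2 : (1 - q) * y ^ (1 - q - 1) / (1 - q) = y ^ (-q) := by
    rw [show 1 - q - 1 = -q by ring]
    field_simp [show 1 - q ≠ 0 by linarith]
  rw [e2, e1]
  ring

lemma gx_deriv (q y : ℝ) (hy : 0 < y) : HasDerivAt (gx q) (-H2 q y) y := by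
  unfold gx
  have h1 := Real.hasDerivAt_rpow_const (x := y) (p := -q) (Or.inl hy.ne')
  have h2 : HasDerivAt (fun y : ℝ => (2 : ℝ) ^ (-q - 1) * y) (2 ^ (-q - 1)) y := by
    simpa using (hasDerivAt_id y).const_mul ((2 : ℝ) ^ (-q - 1))
  refine (h1.sub h2).congr_deriv ?_
  unfold H2
  ring

lemma Hx_contDiffAt (q y : ℝ) (hy : 0 < y) : ContDiffAt ℝ 2 (Hx q) y := by
  unfold Hx
  have : ContDiffAt ℝ 2 (fun y : ℝ => y ^ (1 - q)) y := Real.contDiffAt_rpow_const_of_ne hy.ne'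
  fun_prop

lemma Hx_taylor (q y : ℝ) (hq1 : q < 1) (hy : 0 < y) (κ : ℝ) (hκ : 0 < κ) :
    ∀ᶠ s in 𝓝 (0 : ℝ), Hx q (y + s) ≤ Hx q y - gx q y * s + (1 / 2) * H2 q y * s ^ 2 + κ * s ^ 2 := by
  filter_upwards [taylor2 (Hx_contDiffAt q y hy) κ hκ] with s hs
  have h1 : fderiv ℝ (Hx q) y s = -gx q y * s := by
    rw [(Hx_deriv q y hq1 hy).hasFDerivAt.fderiv]
    simp [mul_comm]
  have h2 : fderiv ℝ (fderiv ℝ (Hx q)) y s s = H2 q y * s ^ 2 := by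
    have hd : DifferentiableAt ℝ (fderiv ℝ (Hx q)) y :=
      ((Hx_contDiffAt q y hy).fderiv_right (m := 1) (by norm_num)).differentiableAt (by norm_num)
    have e1 : HasDerivAt (fun z => fderiv ℝ (Hx q) z s) (fderiv ℝ (fderiv ℝ (Hx q)) y 1 s) y := by
      have := hd.hasFDerivAt.hasDerivAt.clm_apply (hasDerivAt_const y s)
      simpa using this
    have e2 : HasDerivAt (fun z => -gx q z * s) (H2 q y * s) y := by
      simpa using ((gx_deriv q y hy).neg).mul_const s
    have e3 : (fun z => fderiv ℝ (Hx q) z s) =ᶠ[𝓝 y] (fun z => -gx q z * s) := by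
      filter_upwards [Ioi_mem_nhds hy] with z hz
      rw [(Hx_deriv q z hq1 hz).hasFDerivAt.fderiv]
      simp [mul_comm]
    have e4 := e1.unique (e2.congr_of_eventuallyEq e3)
    have e5 : fderiv ℝ (fderiv ℝ (Hx q)) y s = s • fderiv ℝ (fderiv ℝ (Hx q)) y 1 := by
      rw [← map_smul]; simp
    rw [e5]
    simp only [_root_.smul_apply, e4, smul_eq_mul]
    ring
  rw [h1, h2, Real.norm_eq_abs, sq_abs] at hs
  have := (abs_le.1 hs).2
  linarith

lemma Hx_two (q : ℝ) : Hx q 2 = 0 := by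
  unfold Hx; norm_num

lemma gx_factor (q y : ℝ) (hy : 0 < y) : gx q y = y ^ (-q) * (1 - (y / 2) ^ (q + 1)) := by
  unfold gx
  rw [Real.div_rpow hy.le (by norm_num), mul_sub, mul_one]
  congr 1
  rw [show -q - 1 = -(q + 1) by ring, Real.rpow_neg (by norm_num : (0 : ℝ) ≤ 2)]
  have : y ^ (-q) * y ^ (q + 1) = y := by
    rw [← Real.rpow_add hy]; ring_nf; exact Real.rpow_one y
  calc _ = (y ^ (-q) * y ^ (q + 1)) * (2 ^ (q + 1))⁻¹ := by rw [this]; ring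
    _ = _ := by ring

lemma gx_nonneg (q y : ℝ) (hq : 0 < q) (hy : 0 < y) (hy2 : y ≤ 2) : 0 ≤ gx q y := by
  rw [gx_factor q y hy]
  have : (y / 2) ^ (q + 1) ≤ 1 := Real.rpow_le_one (by positivity) (by linarith) (by linarith)
  have h2 : 0 < y ^ (-q) := Real.rpow_pos_of_pos hy _
  apply mul_nonneg h2.le; linarith

lemma gx_nonpos (q y : ℝ) (hq : 0 < q) (hy2 : 2 ≤ y) : gx q y ≤ 0 := by
  have hy : 0 < y := by linarith
  rw [gx_factor q y hy]
  have : 1 ≤ (y / 2) ^ (q + 1) := Real.one_le_rpow (by linarith) (by linarith)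
  have h2 : 0 < y ^ (-q) := Real.rpow_pos_of_pos hy _
  apply mul_nonpos_of_nonneg_of_nonpos h2.le; linarith

lemma gx_le (q y : ℝ) (hy : 0 < y) : gx q y ≤ y ^ (-q) := by
  unfold gx
  have : (0 : ℝ) < 2 ^ (-q - 1) := by positivity
  nlinarith

lemma Hx_anti (q : ℝ) (hq : 0 < q) (hq1 : q < 1) : AntitoneOn (Hx q) (Icc 0 2) := by
  refine antitoneOn_of_deriv_nonpos (convex_Icc _ _) (Hx_cont q hq1).continuousOn ?_ ?_
  · rw [interior_Icc]
    intro t ht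
    exact (Hx_deriv q t hq1 ht.1).differentiableAt.differentiableWithinAt
  · rw [interior_Icc]
    intro t ht
    rw [(Hx_deriv q t hq1 ht.1).deriv]
    linarith [gx_nonneg q t hq ht.1 ht.2.le]

lemma Hx_mono (q : ℝ) (hq : 0 < q) (hq1 : q < 1) : MonotoneOn (Hx q) (Ici 2) := by
  refine monotoneOn_of_deriv_nonneg (convex_Ici _) (Hx_cont q hq1).continuousOn ?_ ?_
  · rw [interior_Ici]
    intro t ht
    have : (0 : ℝ) < t := lt_trans (by norm_num) ht
    exact (Hx_deriv q t hq1 this).differentiableAt.differentiableWithinAt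
  · rw [interior_Ici]
    intro t ht
    have : (0 : ℝ) < t := lt_trans (by norm_num) ht
    rw [(Hx_deriv q t hq1 this).deriv]
    linarith [gx_nonpos q t hq (le_of_lt ht)]

/-- The truncated profile. -/
def Hf (q y : ℝ) : ℝ := Hx q (min y 2)

lemma Hf_cont (q : ℝ) (hq1 : q < 1) : Continuous (Hf q) :=
  (Hx_cont q hq1).comp (continuous_id.min continuous_const)

lemma Hf_anti (q : ℝ) (hq : 0 < q) (hq1 : q < 1) {a b : ℝ} (ha : 0 ≤ a) (hab : a ≤ b) :
    Hf q b ≤ Hf q a :=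
  Hx_anti q hq hq1 ⟨le_min ha (by norm_num), min_le_right _ _⟩
    ⟨le_min (ha.trans hab) (by norm_num), min_le_right _ _⟩ (min_le_min_right _ hab)

lemma Hf_le_Hx (q y : ℝ) (hq : 0 < q) (hq1 : q < 1) : Hf q y ≤ Hx q y := by
  unfold Hf
  rcases le_total y 2 with h | h
  · rw [min_eq_left h]
  · rw [min_eq_right h]
    exact Hx_mono q hq hq1 (by simp) h h

lemma Hf_of_ge (q y : ℝ) (h : 2 ≤ y) : Hf q y = 0 := by
  unfold Hf; rw [min_eq_right h, Hx_two]

lemma Hf_nonneg (q y : ℝ) (hq : 0 < q) (hq1 : q < 1) (hy : 0 ≤ y) : 0 ≤ Hf q y := by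
  have h := Hf_anti q hq hq1 hy (le_max_left y 2)
  rwa [Hf_of_ge q _ (le_max_right y 2)] at h

lemma Hf_le (q y : ℝ) (hq : 0 < q) (hq1 : q < 1) (hy : 0 ≤ y) :
    Hf q y ≤ 2 ^ (1 - q) / (1 - q) := by
  refine (Hf_anti q hq hq1 le_rfl hy).trans ?_
  unfold Hf Hx
  rw [min_eq_left (by norm_num), Real.zero_rpow (by linarith)]
  have : (0 : ℝ) < 2 ^ (-q - 2) := by positivity
  simp
  positivity

/-- The key profile inequality. -/
lemma profile_ineq (q p y : ℝ) (hq : 0 < q) (hq1 : q < 1) (hp : p = 1 + 1 / q) (hy : 0 < y) (hy2 : y ≤ 2) :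
    H2 q y ≤ 1 + gx q y ^ p - (1 - q ^ q) * y ^ (-q - 1) := by
  set s := (y / 2) ^ (q + 1) with hs
  set Y := y ^ (-q - 1) with hY
  have hYpos : 0 < Y := Real.rpow_pos_of_pos hy _
  have hs0 : 0 < s := Real.rpow_pos_of_pos (by positivity) _
  have hs1 : s ≤ 1 := Real.rpow_le_one (by positivity) (by linarith) (by linarith)
  have hYs : Y * s * 2 ^ (q + 1) = 1 := by
    rw [hs, hY, Real.div_rpow hy.le (by norm_num), mul_assoc, div_mul_cancel₀ _ (by positivity),
      ← Real.rpow_add hy]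
    simp
  have hT : (2 : ℝ) ^ (-q - 1) = Y * s := by
    rw [show -q - 1 = -(q + 1) by ring, Real.rpow_neg (by norm_num : (0 : ℝ) ≤ 2)]
    exact inv_eq_of_mul_eq_one_left hYs
  have hg : gx q y ^ p = Y * (1 - s) ^ p := by
    rw [gx_factor q y hy, Real.mul_rpow (Real.rpow_nonneg hy.le _) (by linarith), ← Real.rpow_mul hy.le]
    congr 2
    rw [hp]; field_simp; ring
  set t := q ^ q with ht
  have ht0 : 0 < t := Real.rpow_pos_of_pos hq _
  have htp : t ^ p = q * t := by
    rw [hp, Real.rpow_add ht0, Real.rpow_one, ht, ← Real.rpow_mul hq.le]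
    rw [show q * (1 / q) = 1 by field_simp, Real.rpow_one]; ring
  have hp1 : 1 ≤ p := by rw [hp]; have : 0 < 1 / q := by positivity
                         linarith
  have hpq : p * q = q + 1 := by rw [hp]; field_simp; 
  have hbern : (1 + q) * (1 - s) - t ≤ (1 - s) ^ p := by
    have h1 := one_add_mul_self_le_rpow_one_add (s := (1 - s) / t - 1)
      (by have : 0 ≤ (1 - s) / t := div_nonneg (by linarith) ht0.le
          linarith) hp1
    have h2 : (1 - s) ^ p = t ^ p * (1 + ((1 - s) / t - 1)) ^ p := by
      rw [← Real.mul_rpow ht0.le]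
      · congr 1; field_simp; ring
      · have : 0 ≤ (1 - s) / t := div_nonneg (by linarith) ht0.le
        linarith
    rw [h2, htp]
    have h3 := mul_le_mul_of_nonneg_left h1 (show 0 ≤ q * t by positivity)
    have h4 : q * t * (1 + p * ((1 - s) / t - 1)) = q * t + (p * q) * (1 - s) - (p * q) * t := by
      field_simp
      ring
    rw [h4, hpq] at h3
    linarith
  have h2q : 2 + q ≤ (2 : ℝ) ^ (q + 1) := by
    rw [Real.rpow_add_one (by norm_num), Real.rpow_def_of_pos (by norm_num)]
    have := Real.add_one_le_exp (Real.log 2 * q)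
    nlinarith [Real.log_two_gt_d9]
  unfold H2
  rw [hT, hg]
  have key : q + s + (1 - t) ≤ 2 ^ (q + 1) * s + (1 - s) ^ p := by nlinarith
  have := mul_le_mul_of_nonneg_left key hYpos.le
  linarith

set_option maxHeartbeats 1000000 in
/-- Final inequality in the boundary layer. -/
lemma layer_ineq (q p K M1 M2 : ℝ) (hq : 0 < q) (hq1 : q < 1) (hp : p = 1 + 1 / q) (hK : 0 ≤ K)
    (hM1 : 0 ≤ M1) (hM2 : 0 ≤ M2) :
    ∀ᶠ ε in 𝓝[>] (0 : ℝ), ∀ y, 0 < y → y ≤ 2 → ∀ a W x Lw f0 : ℝ, 0 ≤ W → 0 ≤ x →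
      a + W ^ p - ε * Lw = f0 → x ^ p ≤ f0 → f0 ≤ K * ε → ε ^ (q / 2) * gx q y - x ≤ W →
      Lw ≤ M1 + M2 * (ε ^ (q / 2) * gx q y) + ε ^ ((q - 1) / 2) * H2 q y →
      a ≤ ε ^ ((1 + q) / 2) := by
  have hpq : p * q = q + 1 := by rw [hp]; field_simp
  have hp1 : 1 < p := by rw [hp]; have : 0 < 1 / q := by positivity
                         linarith
  have hp0 : 0 < p := by linarith
  have hc : 0 < 1 - q ^ q := by
    have := Real.rpow_lt_one hq.le hq1 hq
    linarith
  have hexp : 0 < 1 / p - q / 2 := by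
    have : 1 / p = q / (q + 1) := by rw [← hpq]; field_simp
    rw [this, sub_pos, div_lt_div_iff₀ (by norm_num) (by linarith)]
    nlinarith
  have hz : ∀ a : ℝ, 0 < a → Tendsto (fun ε : ℝ => ε ^ a) (𝓝[>] 0) (𝓝 0) := by
    intro a ha
    have : ContinuousAt (fun ε : ℝ => ε ^ a) 0 := Real.continuousAt_rpow_const _ _ (Or.inr ha.le)
    have h2 : Tendsto (fun ε : ℝ => ε ^ a) (𝓝 0) (𝓝 0) := by
      simpa [ContinuousAt, Real.zero_rpow ha.ne'] using this
    exact h2.mono_left nhdsWithin_le_nhds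
  have hlim : Tendsto (fun ε : ℝ => 4 * (K + M1) * ε ^ ((1 - q) / 2)
      + 2 * p * K ^ (1 / p) * ε ^ (1 / p - q / 2) + 2 * M2 * ε ^ ((1 : ℝ) / 2)) (𝓝[>] 0) (𝓝 0) := by
    have := (((hz ((1 - q) / 2) (by linarith)).const_mul (4 * (K + M1))).add
      ((hz _ hexp).const_mul (2 * p * K ^ (1 / p)))).add
      ((hz (1 / 2) (by norm_num)).const_mul (2 * M2))
    simpa using this
  filter_upwards [hlim.eventually_lt_const hc, self_mem_nhdsWithin] with ε hε hε0
  replace hε0 : 0 < ε := hε0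
  intro y hy hy2 a W x Lw f0 hW hx heq hxf hf0 hGW hL
  set g := gx q y with hg
  have hg0 : 0 ≤ g := gx_nonneg q y hq hy hy2
  set Y := y ^ (-q - 1) with hY
  have hYpos : 0 < Y := Real.rpow_pos_of_pos hy _
  set G := ε ^ (q / 2) * g with hG
  have hG0 : 0 ≤ G := mul_nonneg (Real.rpow_nonneg hε0.le _) hg0
  -- lower bound for `W ^ p`
  have hWp : G ^ p - p * G ^ (p - 1) * x ≤ W ^ p := by
    rcases eq_or_lt_of_le hG0 with h | h
    · rw [← h, Real.zero_rpow hp0.ne', Real.zero_rpow (by linarith)]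
      have : 0 ≤ W ^ p := Real.rpow_nonneg hW _
      linarith
    · have hGG : G ^ p = G ^ (p - 1) * G := by
        rw [← Real.rpow_add_one h.ne']; ring_nf
      have hGpos : 0 < G ^ (p - 1) := Real.rpow_pos_of_pos h _
      rcases le_total G x with hGx | hGx
      · have : 0 ≤ W ^ p := Real.rpow_nonneg hW _
        have h5 : G ^ (p - 1) * G ≤ G ^ (p - 1) * x := by gcongr
        have h6 : 0 ≤ G ^ (p - 1) * x := by positivity
        nlinarith
      · have h1 := one_add_mul_self_le_rpow_one_add (s := -(x / G))
          (by have : x / G ≤ 1 := (div_le_one h).2 hGx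
              linarith) hp1.le
        have h2 : (G - x) ^ p = G ^ p * (1 + -(x / G)) ^ p := by
          rw [← Real.mul_rpow hG0]
          · congr 1; field_simp; ring
          · have : x / G ≤ 1 := (div_le_one h).2 hGx
            linarith
        have h3 : (G - x) ^ p ≤ W ^ p := Real.rpow_le_rpow (by linarith) hGW hp0.le
        have h4 := mul_le_mul_of_nonneg_left h1 (Real.rpow_nonneg hG0 p)
        have h5 : G ^ p * (1 + p * -(x / G)) = G ^ p - p * G ^ (p - 1) * x := by
          rw [hGG]; field_simp; ring
        linarith
  have hGp : G ^ p = ε ^ ((1 + q) / 2) * g ^ p := by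
    rw [hG, Real.mul_rpow (Real.rpow_nonneg hε0.le _) hg0, ← Real.rpow_mul hε0.le]
    congr 2
    rw [show q / 2 * p = (p * q) / 2 by ring, hpq]; ring
  have hy1 : y⁻¹ ≤ 2 * Y := by
    have h1 : y⁻¹ = Y * y ^ q := by
      rw [hY, ← Real.rpow_add hy, show -q - 1 + q = -1 by ring, Real.rpow_neg_one]
    have h2 : y ^ q ≤ 2 := by
      calc y ^ q ≤ 2 ^ q := Real.rpow_le_rpow hy.le hy2 hq.le
        _ ≤ 2 ^ (1 : ℝ) := Real.rpow_le_rpow_of_exponent_le (by norm_num) hq1.le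
        _ = 2 := by norm_num
    rw [h1]; nlinarith
  have hyq : y ^ (-q) ≤ 2 * Y := by
    have h1 : y ^ (-q) = Y * y := by
      rw [hY, ← Real.rpow_add_one hy.ne']; ring_nf
    rw [h1]; nlinarith
  have hone : 1 ≤ 4 * Y := by
    have h1 : Y * (y ^ q * y) = 1 := by
      rw [hY, ← Real.rpow_add_one hy.ne', ← Real.rpow_add hy]; ring_nf; exact Real.rpow_zero y
    have h2 : y ^ q ≤ 2 := by
      calc y ^ q ≤ 2 ^ q := Real.rpow_le_rpow hy.le hy2 hq.le
        _ ≤ 2 ^ (1 : ℝ) := Real.rpow_le_rpow_of_exponent_le (by norm_num) hq1.le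
        _ = 2 := by norm_num
    have h3 : y ^ q * y ≤ 2 * 2 := by
      apply mul_le_mul h2 hy2 hy.le (by norm_num)
    nlinarith
  have hGp1 : G ^ (p - 1) ≤ ε ^ ((1 : ℝ) / 2) * (2 * Y) := by
    rw [hG, Real.mul_rpow (Real.rpow_nonneg hε0.le _) hg0, ← Real.rpow_mul hε0.le,
      show q / 2 * (p - 1) = 1 / 2 by rw [show q / 2 * (p - 1) = (p * q - q) / 2 by ring, hpq]; ring]
    gcongr
    refine le_trans ?_ hy1
    calc g ^ (p - 1) ≤ (y ^ (-q)) ^ (p - 1) :=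
          Real.rpow_le_rpow hg0 (gx_le q y hy) (by linarith)
      _ = y⁻¹ := by
          rw [← Real.rpow_mul hy.le, show -q * (p - 1) = -1 by
            rw [show -q * (p - 1) = -(p * q - q) by ring, hpq]; ring, Real.rpow_neg_one]
  have hxb : x ≤ K ^ (1 / p) * ε ^ (1 / p) := by
    rw [← Real.mul_rpow hK hε0.le]
    calc x = (x ^ p) ^ (1 / p) := by
          rw [← Real.rpow_mul hx, mul_one_div_cancel hp0.ne', Real.rpow_one]
      _ ≤ _ := Real.rpow_le_rpow (Real.rpow_nonneg hx _) (hxf.trans hf0) (by positivity)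
  have hprof := profile_ineq q p y hq hq1 hp hy hy2
  -- exponents
  set β := (1 + q) / 2 with hβ
  set Eβ := ε ^ β with hEβ
  have hEβ0 : 0 < Eβ := Real.rpow_pos_of_pos hε0 _
  have x1 : ε = ε ^ ((1 - q) / 2) * Eβ := by
    rw [hEβ, ← Real.rpow_add hε0, hβ]; ring_nf; exact (Real.rpow_one ε).symm
  have x2 : ε ^ ((1 : ℝ) / 2) * ε ^ (1 / p) = ε ^ (1 / p - q / 2) * Eβ := by
    rw [hEβ, ← Real.rpow_add hε0, ← Real.rpow_add hε0, hβ]; ring_nf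
  have x3 : ε * ε ^ (q / 2) = ε ^ ((1 : ℝ) / 2) * Eβ := by
    rw [hEβ, ← Real.rpow_add hε0, mul_comm, ← Real.rpow_add_one hε0.ne', hβ]; ring_nf
  have x4 : ε * ε ^ ((q - 1) / 2) = Eβ := by
    rw [hEβ, mul_comm, ← Real.rpow_add_one hε0.ne', hβ]; ring_nf
  -- assemble
  have b1 : p * G ^ (p - 1) * x ≤ 2 * p * K ^ (1 / p) * (ε ^ (1 / p - q / 2) * Eβ) * Y := by
    rw [← x2]
    calc p * G ^ (p - 1) * x ≤ p * (ε ^ ((1 : ℝ) / 2) * (2 * Y)) * (K ^ (1 / p) * ε ^ (1 / p)) := by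
          gcongr
      _ = _ := by ring
  have b2 : ε * Lw ≤ ε * M1 + M2 * (ε ^ ((1 : ℝ) / 2) * Eβ) * (2 * Y) + Eβ * H2 q y := by
    have h1 := mul_le_mul_of_nonneg_left hL hε0.le
    have h2 : M2 * (ε * ε ^ (q / 2)) * g ≤ M2 * (ε * ε ^ (q / 2)) * (2 * Y) := by
      gcongr
      exact (gx_le q y hy).trans hyq
    rw [← x3]
    calc _ ≤ _ := h1
      _ = ε * M1 + M2 * (ε * ε ^ (q / 2)) * g + (ε * ε ^ ((q - 1) / 2)) * H2 q y := by rw [hG]; ring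
      _ ≤ _ := by rw [x4]; linarith
  have b3 : (K + M1) * ε ≤ 4 * (K + M1) * (ε ^ ((1 - q) / 2) * Eβ) * Y := by
    rw [← x1]
    have : 0 ≤ (K + M1) * ε := by positivity
    nlinarith
  have b4 := mul_le_mul_of_nonneg_left hprof hEβ0.le
  have b5 : (4 * (K + M1) * ε ^ ((1 - q) / 2)
      + 2 * p * K ^ (1 / p) * ε ^ (1 / p - q / 2) + 2 * M2 * ε ^ ((1 : ℝ) / 2)) * (Eβ * Y) ≤
      (1 - q ^ q) * (Eβ * Y) := by
    gcongr
  rw [hGp] at hWp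
  linarith

section Setup
variable {n : ℕ}

lemma setup_U (Ω : Set (EuclideanSpace ℝ (Fin n))) (hΩo : IsOpen Ω) (hΩb : IsBounded Ω)
    (hΩne : Ω.Nonempty) (hne : Ω ≠ univ) (p lam : ℝ) (hp : 2 < p) (hlam : 0 < lam)
    (f : EuclideanSpace ℝ (Fin n) → ℝ)
    (hf_C2 : ContDiffOn ℝ 2 f (closure Ω))
    (hf_nonneg : ∀ x ∈ closure Ω, 0 ≤ f x)
    (hf_bdry : ∀ x ∈ frontier Ω, f x = 0)
    (hDf_bdry : ∀ x ∈ frontier Ω, fderivWithin ℝ f (closure Ω) x = 0)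
    (u : EuclideanSpace ℝ (Fin n) → ℝ) (hu_cont : ContinuousOn u (closure Ω))
    (hu_sub : ViscSubIn1 Ω lam p f u) (hu_sup : ViscSupOn1 Ω lam p f u) :
    (∀ x ∈ closure Ω, 0 ≤ u x) ∧ Continuous (Ω.indicator u) ∧
    ∃ K L : ℝ, 0 ≤ K ∧ 0 ≤ L ∧
      (∀ x y, Ω.indicator u x ≤ Ω.indicator u y + L * ‖x - y‖) ∧
      (∀ x h, Ω.indicator u (x + h) + Ω.indicator u (x - h) - 2 * Ω.indicator u x
        ≤ K / lam * ‖h‖ ^ 2) ∧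
      ∀ y ∈ Ω, f y ≤ K * (Metric.infDist y Ωᶜ) ^ 2 := by
  have hfc : ContinuousOn f (closure Ω) := hf_C2.continuousOn
  have hu0 := u_nonneg Ω hΩb p lam hp hlam f u hf_nonneg hu_cont hu_sup
  have hule := u_le Ω hΩo hΩb p lam hlam f u hfc hu_cont hu_sub
  have hule' : ∀ x ∈ closure Ω, lam * u x ≤ f x := by
    intro x hx
    have := closure_minimal (s := Ω) (t := {x ∈ closure Ω | lam * u x ≤ f x})
      (fun y hy => ⟨subset_closure hy, hule y hy⟩)
      (isClosed_closure.isClosed_le (continuousOn_const.mul hu_cont) hfc)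
    exact (this hx).2
  have hub : ∀ x ∈ frontier Ω, u x = 0 := by
    intro x hx
    have h1 := hule' x (frontier_subset_closure hx)
    have h2 := hu0 x (frontier_subset_closure hx)
    rw [hf_bdry x hx] at h1
    nlinarith
  have hUc : Continuous (Ω.indicator u) := continuous_indicator hub hu_cont
  have hFc : Continuous (Ω.indicator f) := continuous_indicator hf_bdry hfc
  obtain ⟨K, hK0, hK1, hK2⟩ := data_semiconc Ω hΩo hΩb hne f hf_C2 hf_bdry hDf_bdry
  have hU0 : ∀ x, 0 ≤ Ω.indicator u x :=
    fun x => indicator_nonneg (fun y hy => hu0 y (subset_closure hy)) x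
  obtain ⟨B, hB⟩ := hΩb.isCompact_closure.bddAbove_image hu_cont
  have hcl : (closure Ω).Nonempty := hΩne.closure
  obtain ⟨z, hz⟩ := hcl
  have hB0 : 0 ≤ B := (hu0 z hz).trans (hB ⟨z, hz, rfl⟩)
  have hUB : ∀ x, Ω.indicator u x ≤ B := by
    intro x
    by_cases hx : x ∈ Ω
    · rw [indicator_of_mem hx]; exact hB ⟨x, subset_closure hx, rfl⟩
    · rw [indicator_of_notMem hx]; exact hB0
  obtain ⟨B', hB'⟩ := hΩb.isCompact_closure.bddAbove_image hfc
  have hB'0 : 0 ≤ B' := (hf_nonneg z hz).trans (hB' ⟨z, hz, rfl⟩)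
  have hFB : ∀ x, Ω.indicator f x ≤ B' := by
    intro x
    by_cases hx : x ∈ Ω
    · rw [indicator_of_mem hx]; exact hB' ⟨x, subset_closure hx, rfl⟩
    · rw [indicator_of_notMem hx]; exact hB'0
  have hsub := ext_sub Ω hΩo p lam hp f u hu0 hu_sub
  have hsup := ext_sup Ω hΩo p lam f u hu_sup
  obtain ⟨R, hR⟩ := hΩb.exists_norm_le
  have hFu : UniformContinuous (Ω.indicator f) := by
    apply hFc.uniformContinuous_of_tendsto_cocompact (x := 0)
    refine HasCompactSupport.is_zero_at_infty ?_
    refine HasCompactSupport.intro hΩb.isCompact_closure ?_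
    intro x hx
    exact indicator_of_notMem (fun h => hx (subset_closure h)) _
  refine ⟨hu0, hUc, K, B' + 1, hK0, by linarith, ?_, ?_, hK2⟩
  · refine lip_of_sub _ _ lam p (B' + 1) B hlam hUc hU0 hUB (by linarith) ?_ hsub
    intro x
    have h1 : (B' + 1) ^ (1 : ℝ) ≤ (B' + 1) ^ p :=
      Real.rpow_le_rpow_of_exponent_le (by linarith) (by linarith)
    rw [Real.rpow_one] at h1
    have := hFB x
    linarith
  · refine semiconc_of_visc _ _ lam p K B R hlam (by linarith) hUc hFu hU0 hUB hK0 ?_ hsub hsup hK1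
    intro x hx
    apply indicator_of_notMem
    intro h
    have := hR x h
    linarith

lemma lapl_le_of (w : EuclideanSpace ℝ (Fin n) → ℝ) (x0 e : EuclideanSpace ℝ (Fin n)) (K c1 c2 : ℝ)
    (h : ∀ v, fderiv ℝ (fderiv ℝ w) x0 v v - c1 * ‖v‖ ^ 2 - c2 * (inner ℝ e v) ^ 2 ≤ K * ‖v‖ ^ 2) :
    lapl w x0 ≤ n * K + n * c1 + c2 * ‖e‖ ^ 2 := by
  unfold lapl
  have h1 : ∀ i : Fin n, fderiv ℝ (fderiv ℝ w) x0 (EuclideanSpace.single i 1)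
      (EuclideanSpace.single i 1) ≤ K + c1 + c2 * (e i) ^ 2 := by
    intro i
    have := h (EuclideanSpace.single i 1)
    simp [EuclideanSpace.inner_single_right] at this
    linarith
  refine (Finset.sum_le_sum fun i _ => h1 i).trans ?_
  rw [Finset.sum_add_distrib, ← Finset.mul_sum, EuclideanSpace.real_norm_sq_eq]
  have : ∑ i : Fin n, (K + c1) = n * K + n * c1 := by simp [mul_add]
  linarith

lemma interior_step (U F w : EuclideanSpace ℝ (Fin n) → ℝ) (lam p K : ℝ)
    (hsc : ∀ x h, U (x + h) + U (x - h) - 2 * U x ≤ K * ‖h‖ ^ 2)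
    (hsub : ∀ (x ξ : EuclideanSpace ℝ (Fin n)) (C : ℝ), (∀ᶠ v in 𝓝 (0 : EuclideanSpace ℝ (Fin n)),
      U (x + v) ≤ U x + inner ℝ ξ v + C * ‖v‖ ^ 2) → lam * U x + ‖ξ‖ ^ p ≤ F x)
    (hsup : ∀ (x ξ : EuclideanSpace ℝ (Fin n)) (C : ℝ), (∀ᶠ v in 𝓝 (0 : EuclideanSpace ℝ (Fin n)),
      U x + inner ℝ ξ v - C * ‖v‖ ^ 2 ≤ U (x + v)) → F x ≤ lam * U x + ‖ξ‖ ^ p)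
    (x0 e : EuclideanSpace ℝ (Fin n)) (hw : ContDiffAt ℝ 2 w x0) (c0 c1 c2 : ℝ)
    (h : ∀ κ > 0, ∀ᶠ v in 𝓝 (0 : EuclideanSpace ℝ (Fin n)),
      w (x0 + v) - U (x0 + v) ≤ w x0 - U x0 - c0 * inner ℝ e v
        + (1 / 2) * (c1 * ‖v‖ ^ 2 + c2 * (inner ℝ e v) ^ 2) + κ * ‖v‖ ^ 2) :
    lam * U x0 + ‖gradient w x0 + c0 • e‖ ^ p = F x0 ∧
      lapl w x0 ≤ n * K + n * c1 + c2 * ‖e‖ ^ 2 := by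
  set A := fderiv ℝ (fderiv ℝ w) x0 with hA
  have key := touch_below U F lam p K hsc hsub hsup x0 (gradient w x0 + c0 • e)
    (fun v => A v v - c1 * ‖v‖ ^ 2 - c2 * (inner ℝ e v) ^ 2) (by
      intro t v
      simp only [map_smul, _root_.smul_apply, smul_eq_mul, norm_smul, real_inner_smul_right, mul_pow,
        Real.norm_eq_abs, sq_abs]
      ring) (‖A‖ + |c1| + |c2| * ‖e‖ ^ 2) (by
      intro v
      have h1 : |A v v| ≤ ‖A‖ * ‖v‖ ^ 2 := by
        have := A.le_opNorm₂ v v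
        rw [Real.norm_eq_abs] at this
        linarith
      have h2 : |c1 * ‖v‖ ^ 2| = |c1| * ‖v‖ ^ 2 := by rw [abs_mul, abs_of_nonneg (sq_nonneg ‖v‖)]
      have h3 : |c2 * (inner ℝ e v) ^ 2| ≤ |c2| * ‖e‖ ^ 2 * ‖v‖ ^ 2 := by
        rw [abs_mul, abs_of_nonneg (sq_nonneg (inner ℝ e v)), mul_assoc, ← mul_pow]
        refine mul_le_mul_of_nonneg_left ?_ (abs_nonneg _)
        rw [← sq_abs]
        gcongr
        exact abs_real_inner_le_norm e v
      calc _ ≤ |A v v| + |c1 * ‖v‖ ^ 2| + |c2 * (inner ℝ e v) ^ 2| :=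
            (abs_sub _ _).trans (by gcongr; exact abs_sub _ _)
        _ ≤ _ := by rw [h2]; linarith) (by
      intro κ hκ
      filter_upwards [h (κ / 2) (by linarith), taylor2 hw (κ / 2) (by linarith)] with v h1 h2
      have h3 := (abs_le.1 h2).1
      have h4 : fderiv ℝ w x0 v = inner ℝ (gradient w x0) v := by
        unfold gradient
        rw [InnerProductSpace.toDual_symm_apply]
      rw [h4] at h3
      rw [inner_add_left, real_inner_smul_left]
      linarith)
  exact ⟨key.1, lapl_le_of w x0 e K c1 c2 key.2⟩

end Setup

lemma layer_touch {E : Type*} [NormedAddCommGroup E] [InnerProductSpace ℝ E]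
    (q r σ y0 : ℝ) (hq : 0 < q) (hq1 : q < 1) (hr : 0 < r) (hσ : 0 < σ) (hy : 0 < y0) (hy2 : y0 ≤ 2)
    (e : E) (he : ‖e‖ = 1) (κ : ℝ) (hκ : 0 < κ) :
    ∀ᶠ v in 𝓝 (0 : E), 0 ≤ y0 + (inner ℝ e v - ‖v‖ ^ 2 / (2 * r)) / σ ∧
      Hf q (y0 + (inner ℝ e v - ‖v‖ ^ 2 / (2 * r)) / σ) ≤ Hf q y0 - gx q y0 / σ * inner ℝ e v
        + (1 / 2) * (gx q y0 / σ / r * ‖v‖ ^ 2 + H2 q y0 / σ ^ 2 * (inner ℝ e v) ^ 2)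
        + κ * ‖v‖ ^ 2 := by
  have hs : Tendsto (fun v : E => (inner ℝ e v - ‖v‖ ^ 2 / (2 * r)) / σ) (𝓝 0) (𝓝 0) := by
    have : Continuous (fun v : E => (inner ℝ e v - ‖v‖ ^ 2 / (2 * r)) / σ) := by fun_prop
    simpa using this.tendsto 0
  have hH2 : 0 < H2 q y0 := by
    unfold H2
    have := Real.rpow_pos_of_pos hy (-q - 1)
    positivity
  -- the small parameters
  obtain ⟨τ, hτ, hτκ⟩ : ∃ τ > 0, τ * H2 q y0 / σ ^ 2 ≤ κ := by
    refine ⟨κ * σ ^ 2 / H2 q y0, by positivity, ?_⟩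
    field_simp; exact le_rfl
  set κ' := κ * σ ^ 2 / (2 * (1 + τ)) with hκ'
  have hκ'0 : 0 < κ' := by positivity
  have hsmall : ∀ᶠ v in 𝓝 (0 : E), ‖v‖ / r + ‖v‖ ^ 2 / (4 * r ^ 2) < τ := by
    have : Continuous (fun v : E => ‖v‖ / r + ‖v‖ ^ 2 / (4 * r ^ 2)) := by fun_prop
    have h2 : Tendsto (fun v : E => ‖v‖ / r + ‖v‖ ^ 2 / (4 * r ^ 2)) (𝓝 0) (𝓝 0) := by
      simpa using this.tendsto 0
    exact h2.eventually_lt_const hτ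
  filter_upwards [hs.eventually (Hx_taylor q y0 hq1 hy κ' hκ'0),
    hs.eventually (Ioi_mem_nhds (show -y0 < 0 by linarith)), hsmall] with v h1 h2 h3
  have h2' : -y0 < (inner ℝ e v - ‖v‖ ^ 2 / (2 * r)) / σ := h2
  refine ⟨by linarith, ?_⟩
  refine (Hf_le_Hx q _ hq hq1).trans ?_
  refine h1.trans ?_
  have e0 : Hf q y0 = Hx q y0 := by unfold Hf; rw [min_eq_left hy2]
  rw [e0]
  have ha := abs_real_inner_le_norm e v
  rw [he, one_mul] at ha
  set a := inner ℝ e v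
  set N := ‖v‖
  have hN : 0 ≤ N := norm_nonneg v
  have hsq : (a - N ^ 2 / (2 * r)) ^ 2 ≤ a ^ 2 + τ * N ^ 2 := by
    have b1 : (a - N ^ 2 / (2 * r)) ^ 2 = a ^ 2 + (-a) * N ^ 2 / r + N ^ 2 * (N ^ 2 / (4 * r ^ 2)) := by
      field_simp; ring
    have b2 : (-a) * N ^ 2 / r ≤ N * N ^ 2 / r := by
      gcongr
      exact (neg_le_abs a).trans ha
    have b3 : N * N ^ 2 / r + N ^ 2 * (N ^ 2 / (4 * r ^ 2)) = N ^ 2 * (N / r + N ^ 2 / (4 * r ^ 2)) := by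
      ring
    nlinarith [sq_nonneg N]
  have hsq1 : a ^ 2 ≤ N ^ 2 := by rw [← sq_abs]; gcongr
  have hs2 : ((a - N ^ 2 / (2 * r)) / σ) ^ 2 ≤ a ^ 2 / σ ^ 2 + τ * N ^ 2 / σ ^ 2 := by
    rw [div_pow, ← add_div]
    gcongr
  have hs3 : κ' * ((a - N ^ 2 / (2 * r)) / σ) ^ 2 ≤ κ / 2 * N ^ 2 := by
    have b1 : ((a - N ^ 2 / (2 * r)) / σ) ^ 2 ≤ (1 + τ) * N ^ 2 / σ ^ 2 := by
      rw [div_pow]; gcongr; linarith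
    calc _ ≤ κ' * ((1 + τ) * N ^ 2 / σ ^ 2) := by gcongr
      _ = κ / 2 * N ^ 2 := by rw [hκ']; field_simp
  have hs4 : 1 / 2 * H2 q y0 * ((a - N ^ 2 / (2 * r)) / σ) ^ 2 ≤
      1 / 2 * (H2 q y0 / σ ^ 2 * a ^ 2) + κ / 2 * N ^ 2 := by
    calc _ ≤ 1 / 2 * H2 q y0 * (a ^ 2 / σ ^ 2 + τ * N ^ 2 / σ ^ 2) := by gcongr
      _ = 1 / 2 * (H2 q y0 / σ ^ 2 * a ^ 2) + 1 / 2 * (τ * H2 q y0 / σ ^ 2) * N ^ 2 := by ring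
      _ ≤ 1 / 2 * (H2 q y0 / σ ^ 2 * a ^ 2) + 1 / 2 * κ * N ^ 2 := by gcongr
      _ = _ := by ring
  have hs5 : gx q y0 * ((a - N ^ 2 / (2 * r)) / σ) = gx q y0 / σ * a - 1 / 2 * (gx q y0 / σ / r * N ^ 2) := by
    field_simp
  rw [hs5]
  linarith

/-- The profile has an infinite slope at the origin. -/
lemma steep (q c C b : ℝ) (hq : 0 < q) (hq1 : q < 1) (hc : 0 < c) (hb : 0 < b)
    (h : ∀ᶠ t in 𝓝[>] (0 : ℝ), b * (Hf q 0 - Hf q (t / c)) ≤ C * t) : False := by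
  have h1 : Tendsto (fun t : ℝ => t / c) (𝓝[>] 0) (𝓝 0) := by
    have : Continuous (fun t : ℝ => t / c) := by fun_prop
    have h2 : Tendsto (fun t : ℝ => t / c) (𝓝 0) (𝓝 0) := by simpa using this.tendsto 0
    exact h2.mono_left nhdsWithin_le_nhds
  have h2 : Tendsto (fun t : ℝ => t / c) (𝓝[>] 0) (𝓝[>] 0) := by
    refine tendsto_nhdsWithin_iff.2 ⟨h1, ?_⟩
    filter_upwards [self_mem_nhdsWithin] with t ht
    exact div_pos ht hc
  have h3 : Tendsto (fun y : ℝ => (y ^ q)⁻¹) (𝓝[>] 0) atTop := by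
    apply Tendsto.comp tendsto_inv_nhdsGT_zero
    refine tendsto_nhdsWithin_iff.2 ⟨?_, ?_⟩
    · have : ContinuousAt (fun ε : ℝ => ε ^ q) 0 := Real.continuousAt_rpow_const _ _ (Or.inr hq.le)
      have h2 : Tendsto (fun ε : ℝ => ε ^ q) (𝓝 0) (𝓝 0) := by
        simpa [ContinuousAt, Real.zero_rpow hq.ne'] using this
      exact h2.mono_left nhdsWithin_le_nhds
    · filter_upwards [self_mem_nhdsWithin] with t ht
      exact Real.rpow_pos_of_pos ht _
  have h4 := (h3.comp h2).eventually_gt_atTop ((1 - q) * (|C| * c / b + 2 ^ (-q - 2) * 2))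
  have h5 := h1.eventually_lt_const (show (0 : ℝ) < 2 by norm_num)
  obtain ⟨t, ⟨⟨⟨ht, ht4⟩, ht5⟩, ht0⟩⟩ := (((h.and h4).and h5).and self_mem_nhdsWithin).exists
  replace ht0 : 0 < t := ht0
  simp only [Function.comp] at ht4
  have htc : t = t / c * c := by field_simp
  set y := t / c with hy
  have hy0 : 0 < y := div_pos ht0 hc
  have e1 : Hf q 0 - Hf q y = y * ((y ^ q)⁻¹ / (1 - q)) - 2 ^ (-q - 2) * y * y := by
    unfold Hf
    rw [min_eq_left (by norm_num), min_eq_left ht5.le]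
    unfold Hx
    rw [Real.zero_rpow (by linarith), Real.rpow_sub hy0, Real.rpow_one]
    ring
  have e2 : |C| * c / b + 2 ^ (-q - 2) * 2 < (y ^ q)⁻¹ / (1 - q) := by
    rw [lt_div_iff₀ (by linarith)]; linarith
  have e3 : (0 : ℝ) < 2 ^ (-q - 2) := by positivity
  have e4 : y * (|C| * c / b) < Hf q 0 - Hf q y := by
    rw [e1]
    have a1 := mul_lt_mul_of_pos_left e2 hy0
    have a2 : 2 ^ (-q - 2) * y * y ≤ 2 ^ (-q - 2) * y * 2 := by gcongr
    nlinarith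
  have e5 : b * (y * (|C| * c / b)) < b * (Hf q 0 - Hf q y) := by gcongr
  have e6 : b * (y * (|C| * c / b)) = |C| * t := by
    rw [htc]; field_simp
  have e7 : C * t ≤ |C| * t := by gcongr; exact le_abs_self C
  linarith

section Compare
variable {n : ℕ}

set_option maxHeartbeats 1000000 in
/-- The comparison argument on `{D ≥ η}`. -/
lemma compare_eta (Ω : Set (EuclideanSpace ℝ (Fin n))) (hΩo : IsOpen Ω) (hΩb : IsBounded Ω)
    (hne : Ω ≠ univ) (p q lam K L r ε η : ℝ) (hq : 0 < q) (hq1 : q < 1)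
    (hlam : 0 < lam) (hK : 0 ≤ K) (hr : 0 < r) (hε : 0 < ε) (hη : 0 < η)
    (hηε : η ≤ √ε) (hεr : 3 * √ε ≤ r)
    (hd : ∀ z ∈ Ω, Metric.infDist z Ωᶜ < 2 * r →
      DifferentiableAt ℝ (fun x => Metric.infDist x Ωᶜ) z)
    (U F f w : EuclideanSpace ℝ (Fin n) → ℝ) (hFf : ∀ x ∈ Ω, F x = f x)
    (hU0 : ∀ x, 0 ≤ U x) (hUc : Continuous U)
    (hUL : ∀ x y, U x ≤ U y + L * ‖x - y‖)
    (hsc : ∀ x h, U (x + h) + U (x - h) - 2 * U x ≤ K / lam * ‖h‖ ^ 2)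
    (hfD : ∀ y ∈ Ω, f y ≤ K * (Metric.infDist y Ωᶜ) ^ 2)
    (hsub : ∀ (x ξ : EuclideanSpace ℝ (Fin n)) (C : ℝ), (∀ᶠ v in 𝓝 (0 : EuclideanSpace ℝ (Fin n)),
      U (x + v) ≤ U x + inner ℝ ξ v + C * ‖v‖ ^ 2) → lam * U x + ‖ξ‖ ^ p ≤ F x)
    (hsup : ∀ (x ξ : EuclideanSpace ℝ (Fin n)) (C : ℝ), (∀ᶠ v in 𝓝 (0 : EuclideanSpace ℝ (Fin n)),
      U x + inner ℝ ξ v - C * ‖v‖ ^ 2 ≤ U (x + v)) → F x ≤ lam * U x + ‖ξ‖ ^ p)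
    (hw : ContDiffOn ℝ 2 w Ω)
    (hweq : ∀ x ∈ Ω, lam * w x + ‖gradient w x‖ ^ p - ε * lapl w x = f x)
    (hlayer : ∀ y, 0 < y → y ≤ 2 → ∀ a W x Lw f0 : ℝ, 0 ≤ W → 0 ≤ x →
      a + W ^ p - ε * Lw = f0 → x ^ p ≤ f0 → f0 ≤ 9 * K * ε → ε ^ (q / 2) * gx q y - x ≤ W →
      Lw ≤ n * (K / lam) + n / r * (ε ^ (q / 2) * gx q y) + ε ^ ((q - 1) / 2) * H2 q y →
      a ≤ ε ^ ((1 + q) / 2))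
    (hεK : ε * (n * (K / lam)) ≤ ε ^ ((1 + q) / 2)) (x : EuclideanSpace ℝ (Fin n))
    (hx : η ≤ Metric.infDist x Ωᶜ) :
    w x - U x ≤ (1 / lam + 2 ^ (1 - q) / (1 - q)) * ε ^ ((1 + q) / 2) := by
  set D : EuclideanSpace ℝ (Fin n) → ℝ := fun x => Metric.infDist x Ωᶜ with hD
  set σ := √ε with hσ
  have hσ0 : 0 < σ := Real.sqrt_pos.2 hε
  have hσ2 : σ ^ 2 = ε := Real.sq_sqrt hε.le
  have hσr : σ = ε ^ ((1 : ℝ) / 2) := Real.sqrt_eq_rpow ε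
  set b := ε ^ ((1 + q) / 2) with hb
  have hb0 : 0 < b := Real.rpow_pos_of_pos hε _
  have hb1 : b / σ = ε ^ (q / 2) := by
    rw [hσr, hb, ← Real.rpow_sub hε]; ring_nf
  have hb2 : b / σ ^ 2 = ε ^ ((q - 1) / 2) := by
    rw [hσ2, hb, ← Real.rpow_sub_one hε.ne']; ring_nf
  have hDc : Continuous D := Metric.continuous_infDist_pt _
  have hDpos : ∀ z, 0 < D z → z ∈ Ω := by
    intro z hz
    by_contra hcon
    have : D z = 0 := Metric.infDist_zero_of_mem (show z ∈ Ωᶜ from hcon)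
    linarith
  set S : Set (EuclideanSpace ℝ (Fin n)) := {x | η ≤ D x} with hS
  have hSΩ : S ⊆ Ω := fun z hz => hDpos z (lt_of_lt_of_le hη hz)
  have hSc : IsCompact S := by
    refine Metric.isCompact_of_isClosed_isBounded ?_ (hΩb.subset hSΩ)
    exact isClosed_le continuous_const hDc
  have hHc := Hf_cont q hq1
  obtain ⟨x0, hx0S, hmax⟩ := hSc.exists_isMaxOn ⟨x, hx⟩
    (f := fun x => w x - U x - b * Hf q ((D x - η) / σ)) (by
      refine ContinuousOn.sub ((hw.continuousOn.mono hSΩ).sub hUc.continuousOn) ?_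
      exact (by fun_prop : Continuous fun x => b * Hf q ((D x - η) / σ)).continuousOn)
  have hx0 : x0 ∈ Ω := hSΩ hx0S
  have hx0D : η ≤ D x0 := hx0S
  have hmax' : ∀ z, η ≤ D z → w z - U z - b * Hf q ((D z - η) / σ) ≤
      w x0 - U x0 - b * Hf q ((D x0 - η) / σ) := fun z hz => hmax hz
  set y0 := (D x0 - η) / σ with hy0
  have hy0n : 0 ≤ y0 := div_nonneg (by linarith) hσ0.le
  have hH0 : 0 ≤ Hf q y0 := Hf_nonneg q y0 hq hq1 hy0n
  have hwx0 : ContDiffAt ℝ 2 w x0 := hw.contDiffAt (hΩo.mem_nhds hx0)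
  have hweq0 := hweq x0 hx0
  have hp0 : ∀ z : EuclideanSpace ℝ (Fin n), 0 ≤ ‖z‖ ^ p := fun z => Real.rpow_nonneg (norm_nonneg z) p
  have main : w x0 - U x0 - b * Hf q y0 ≤ b / lam := by
    suffices hsuf : w x0 - U x0 ≤ b / lam by
      have : 0 ≤ b * Hf q y0 := by positivity
      linarith
    rcases eq_or_lt_of_le hy0n with h0 | h0
    · -- the minimum is on `D = η`: impossible
      exfalso
      have hDη : D x0 = η := by
        have : D x0 - η = y0 * σ := by rw [hy0]; field_simp
        rw [← h0] at this; linarith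
      obtain ⟨e, he, hball⟩ := int_ball Ω hΩo hne r hr hd x0 hx0 (by
        change D x0 ≤ r; linarith)
      have hdw := (hwx0.differentiableAt (by norm_num)).hasFDerivAt
      have hte : Tendsto (fun t : ℝ => t • e) (𝓝[>] 0) (𝓝 0) := by
        have : Continuous (fun t : ℝ => t • e) := by fun_prop
        have h2 : Tendsto (fun t : ℝ => t • e) (𝓝 0) (𝓝 0) := by simpa using this.tendsto 0
        exact h2.mono_left nhdsWithin_le_nhds
      set A1 := fderiv ℝ w x0 e with hA1
      set A2 := fderiv ℝ (fderiv ℝ w) x0 e e with hA2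
      have ht1 : ∀ᶠ t in 𝓝[>] (0 : ℝ), t < r ∧ t < 1 := by
        have : ∀ᶠ t in 𝓝 (0 : ℝ), t < r ∧ t < 1 :=
          (eventually_lt_nhds hr).and (eventually_lt_nhds one_pos)
        exact this.filter_mono nhdsWithin_le_nhds
      refine steep q (2 * σ) (|A1| + |A2| + 1 + L) b hq hq1 (by positivity) hb0 ?_
      filter_upwards [hte.eventually (taylor2 hwx0 1 one_pos), ht1, self_mem_nhdsWithin]
        with t h1 h2 h3
      replace h3 : 0 < t := h3
      have hn : ‖t • e‖ = t := by rw [norm_smul, he, mul_one, Real.norm_eq_abs, abs_of_pos h3]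
      have h4 := hball (t • e)
      rw [hn, real_inner_smul_right, real_inner_self_eq_norm_sq, he] at h4
      have h5 : t ^ 2 / (2 * r) ≤ t / 2 := by
        rw [div_le_div_iff₀ (by positivity) (by norm_num)]
        nlinarith
      have h6 : η + t / 2 ≤ D (x0 + t • e) := by
        change D x0 + _ - _ ≤ D (x0 + t • e) at h4
        linarith
      have h7 := hmax' (x0 + t • e) (by linarith)
      have h8 : Hf q ((D (x0 + t • e) - η) / σ) ≤ Hf q (t / (2 * σ)) := by
        apply Hf_anti q hq hq1 (by positivity)
        rw [div_le_div_iff₀ (by positivity) hσ0]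
        nlinarith
      have h9 : b * Hf q ((D (x0 + t • e) - η) / σ) ≤ b * Hf q (t / (2 * σ)) := by gcongr
      have h10 := hUL (x0 + t • e) x0
      rw [show x0 + t • e - x0 = t • e by abel, hn] at h10
      have h11 := (abs_le.1 h1).1
      rw [hn] at h11
      simp only [map_smul, _root_.smul_apply, smul_eq_mul] at h11
      rw [← hA1, ← hA2] at h11
      have h12 : -(t * A1) ≤ |A1| * t := by nlinarith [neg_abs_le A1]
      have h13 : -(1 / 2 * (t * (t * A2))) ≤ |A2| * t := by
        have : -A2 ≤ |A2| := neg_le_abs A2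
        have h14 : t * (t * -A2) ≤ t * (t * |A2|) := by gcongr
        have h15 : t * (t * |A2|) ≤ t * (1 * |A2|) := by gcongr; exact h2.2.le
        nlinarith [mul_nonneg h3.le (abs_nonneg A2)]
      have h16 : t ^ 2 ≤ t := by nlinarith [h2.2]
      rw [← h0] at h7
      linarith
    · rcases le_or_gt y0 2 with hy2 | hy2
      · have hDx0 : D x0 = η + y0 * σ := by rw [hy0]; field_simp; ring
        have hDx3 : D x0 ≤ 3 * σ := by nlinarith
        obtain ⟨e, he, hball⟩ := int_ball Ω hΩo hne r hr hd x0 hx0 (hDx3.trans hεr)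
        have hg := gx_nonneg q y0 hq h0 hy2
        obtain ⟨k1, k2⟩ := interior_step U F w lam p (K / lam) hsc hsub hsup x0 e hwx0
          (ε ^ (q / 2) * gx q y0) (ε ^ (q / 2) * gx q y0 / r) (ε ^ ((q - 1) / 2) * H2 q y0) (by
            intro κ hκ
            have hDx0pos : ∀ᶠ v in 𝓝 (0 : EuclideanSpace ℝ (Fin n)), η ≤ D (x0 + v) := by
              have hc : Continuous fun v => D (x0 + v) := by fun_prop
              have h1 : Tendsto (fun v => D (x0 + v)) (𝓝 0) (𝓝 (D x0)) := by
                simpa using hc.tendsto 0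
              have h2 : η < D x0 := by rw [hDx0]; have := mul_pos h0 hσ0; linarith
              filter_upwards [h1.eventually_const_lt h2] with v hv
              exact hv.le
            filter_upwards [hDx0pos, layer_touch q r σ y0 hq hq1 hr hσ0 h0 hy2 e he (κ / b)
              (by positivity)] with v h1 h2
            have h3 := hmax' (x0 + v) h1
            have h4 : Hf q ((D (x0 + v) - η) / σ) ≤
                Hf q (y0 + (inner ℝ e v - ‖v‖ ^ 2 / (2 * r)) / σ) := by
              apply Hf_anti q hq hq1 h2.1
              have h5 := hball v
              change D x0 + _ - _ ≤ D (x0 + v) at h5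
              rw [hy0, ← add_div]
              gcongr
              linarith
            have h6 := mul_le_mul_of_nonneg_left (h4.trans h2.2) hb0.le
            have h7 : b * (Hf q y0 - gx q y0 / σ * inner ℝ e v
                + (1 / 2) * (gx q y0 / σ / r * ‖v‖ ^ 2 + H2 q y0 / σ ^ 2 * (inner ℝ e v) ^ 2)
                + κ / b * ‖v‖ ^ 2) = b * Hf q y0 - (b / σ) * gx q y0 * inner ℝ e v
                + (1 / 2) * ((b / σ) * gx q y0 / r * ‖v‖ ^ 2 + (b / σ ^ 2) * H2 q y0 * (inner ℝ e v) ^ 2)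
                + κ * ‖v‖ ^ 2 := by
              field_simp
            rw [h7, hb1, hb2] at h6
            linarith)
        rw [he] at k2
        rw [hFf x0 hx0] at k1
        have hUx := hU0 x0
        have hf9 : f x0 ≤ 9 * K * ε := by
          refine (hfD x0 hx0).trans ?_
          have : (D x0) ^ 2 ≤ (3 * σ) ^ 2 := by
            have : 0 ≤ D x0 := by linarith
            gcongr
          calc K * (D x0) ^ 2 ≤ K * (3 * σ) ^ 2 := by gcongr
            _ = 9 * K * ε := by rw [← hσ2]; ring
        have hcon := hlayer y0 h0 hy2 (lam * w x0) ‖gradient w x0‖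
          ‖gradient w x0 + (ε ^ (q / 2) * gx q y0) • e‖ (lapl w x0) (f x0) (norm_nonneg _)
          (norm_nonneg _) hweq0 (by nlinarith) hf9 (by
            have h1 : ‖(ε ^ (q / 2) * gx q y0) • e‖ = ε ^ (q / 2) * gx q y0 := by
              rw [norm_smul, he, mul_one, Real.norm_eq_abs, abs_of_nonneg]
              have := Real.rpow_nonneg hε.le (q / 2)
              positivity
            have h2 := norm_sub_le (gradient w x0 + (ε ^ (q / 2) * gx q y0) • e) (gradient w x0)
            rw [add_sub_cancel_left, h1] at h2
            linarith) (by
            refine k2.trans (le_of_eq ?_)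
            ring)
        rw [le_div_iff₀ hlam]
        nlinarith
      · obtain ⟨k1, k2⟩ := interior_step U F w lam p (K / lam) hsc hsub hsup x0 0 hwx0
          0 0 0 (by
            intro κ hκ
            have hDx0pos : ∀ᶠ v in 𝓝 (0 : EuclideanSpace ℝ (Fin n)), 2 < (D (x0 + v) - η) / σ := by
              have hc : Continuous fun v => (D (x0 + v) - η) / σ := by fun_prop
              have h1 : Tendsto (fun v => (D (x0 + v) - η) / σ) (𝓝 0) (𝓝 y0) := by
                simpa using hc.tendsto 0
              exact h1.eventually_const_lt hy2
            filter_upwards [hDx0pos] with v h1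
            have h2 := hmax' (x0 + v) (by
              rw [lt_div_iff₀ hσ0] at h1
              linarith)
            rw [Hf_of_ge q _ h1.le, Hf_of_ge q _ hy2.le] at h2
            have : 0 ≤ κ * ‖v‖ ^ 2 := by positivity
            simp only [zero_mul, inner_zero_left]
            linarith)
        rw [hFf x0 hx0] at k1
        simp only [zero_smul, add_zero, mul_zero, zero_mul] at k1 k2
        have k3 := mul_le_mul_of_nonneg_left k2 hε.le
        rw [le_div_iff₀ hlam]
        nlinarith
  have hfin := hmax' x hx
  have hHx := Hf_le q ((D x - η) / σ) hq hq1 (div_nonneg (by linarith) hσ0.le)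
  have hHx' : b * Hf q ((D x - η) / σ) ≤ b * (2 ^ (1 - q) / (1 - q)) := by gcongr
  have : (1 / lam + 2 ^ (1 - q) / (1 - q)) * b = b / lam + b * (2 ^ (1 - q) / (1 - q)) := by ring
  rw [this]
  linarith

end Compare

/-- Improved upper bound
`max_{cl Ω} (u^ε − u) ≤ (1/λ + 2^{α_p}/α_p)·ε^{1 − α_p/2}` for nonnegative `C²(cl Ω)` data
vanishing together with its differential on `∂Ω`, where `α_p = (p−2)/(p−1)`.
The `C²`-boundary assumption is encoded by `0 < δ_Ω`. -/
theorem upper_rate_C2_data {n : ℕ} (Ω : Set (EuclideanSpace ℝ (Fin n)))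
    (hΩo : IsOpen Ω) (hΩb : IsBounded Ω) (hΩne : Ω.Nonempty)
    (hC2 : 0 < deltaOm Ω)
    (p lam : ℝ) (hp : 2 < p) (hlam : 0 < lam)
    (f : EuclideanSpace ℝ (Fin n) → ℝ)
    (hf_C2 : ContDiffOn ℝ 2 f (closure Ω))
    (hf_nonneg : ∀ x ∈ closure Ω, 0 ≤ f x)
    (hf_bdry : ∀ x ∈ frontier Ω, f x = 0)
    (hDf_bdry : ∀ x ∈ frontier Ω, fderivWithin ℝ f (closure Ω) x = 0)
    -- `u` is the state-constraint viscosity solution of `λu + |Du|^p = f`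
    (u : EuclideanSpace ℝ (Fin n) → ℝ) (hu_cont : ContinuousOn u (closure Ω))
    (hu_sub : ViscSubIn1 Ω lam p f u) (hu_sup : ViscSupOn1 Ω lam p f u)
    -- `uε ε` is the maximal solution of the state-constraint problem for
    -- `λu + |Du|^p − εΔu = f`
    (uε : ℝ → EuclideanSpace ℝ (Fin n) → ℝ)
    (huε : ∀ ε : ℝ, 0 < ε →
      ContinuousOn (uε ε) (closure Ω) ∧ ClassicalSolIn Ω lam p ε f (uε ε) ∧
      ViscSupOn Ω lam p ε f (uε ε) ∧ BdryStrict Ω ((p - 2) / (p - 1)) (uε ε)) :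
    ∃ ε₀ > (0:ℝ), ∀ ε : ℝ, 0 < ε → ε < ε₀ → ∀ x ∈ closure Ω,
      uε ε x - u x ≤
        (1 / lam + (2 : ℝ) ^ ((p - 2) / (p - 1)) / ((p - 2) / (p - 1)))
          * ε ^ (1 - ((p - 2) / (p - 1)) / 2) := by
  obtain ⟨hne, r, hr, hd⟩ := dist_diff Ω hΩo hC2
  obtain ⟨hu0, hUc, K, L, hK, hL, hUL, hsc, hfD⟩ := setup_U Ω hΩo hΩb hΩne hne p lam hp hlam f
    hf_C2 hf_nonneg hf_bdry hDf_bdry u hu_cont hu_sub hu_sup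
  have hsub := ext_sub Ω hΩo p lam hp f u hu0 hu_sub
  have hsup := ext_sup Ω hΩo p lam f u hu_sup
  have hU0 : ∀ x, 0 ≤ Ω.indicator u x :=
    fun x => indicator_nonneg (fun y hy => hu0 y (subset_closure hy)) x
  set q := 1 / (p - 1) with hq
  have hp1 : 0 < p - 1 := by linarith
  have hq0 : 0 < q := by positivity
  have hq1 : q < 1 := by rw [hq, div_lt_one hp1]; linarith
  have hpq : p = 1 + 1 / q := by rw [hq]; field_simp; ring
  have hα : (p - 2) / (p - 1) = 1 - q := by rw [hq]; field_simp; ring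
  have hn0 : (0 : ℝ) ≤ n := Nat.cast_nonneg n
  have hz : ∀ a : ℝ, 0 < a → Tendsto (fun ε : ℝ => ε ^ a) (𝓝[>] 0) (𝓝 0) := by
    intro a ha
    have : ContinuousAt (fun ε : ℝ => ε ^ a) 0 := Real.continuousAt_rpow_const _ _ (Or.inr ha.le)
    have h2 : Tendsto (fun ε : ℝ => ε ^ a) (𝓝 0) (𝓝 0) := by
      simpa [ContinuousAt, Real.zero_rpow ha.ne'] using this
    exact h2.mono_left nhdsWithin_le_nhds
  have ev1 := layer_ineq q p (9 * K) (n * (K / lam)) (n / r) hq0 hq1 hpq (by positivity)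
    (by positivity) (by positivity)
  have ev2 : ∀ᶠ ε in 𝓝[>] (0 : ℝ), 3 * √ε < r := by
    have h1 : Continuous fun ε : ℝ => 3 * √ε := by fun_prop
    have h2 : Tendsto (fun ε : ℝ => 3 * √ε) (𝓝 0) (𝓝 0) := by simpa using h1.tendsto 0
    exact (h2.mono_left nhdsWithin_le_nhds).eventually_lt_const hr
  have ev3 : ∀ᶠ ε in 𝓝[>] (0 : ℝ), ε ^ ((1 - q) / 2) * (n * (K / lam)) < 1 := by
    have := (hz ((1 - q) / 2) (by linarith)).mul_const (n * (K / lam))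
    rw [zero_mul] at this
    exact this.eventually_lt_const one_pos
  obtain ⟨ε₀, hε₀, hall⟩ := mem_nhdsGT_iff_exists_Ioo_subset.1 ((ev1.and ev2).and ev3)
  refine ⟨ε₀, hε₀, ?_⟩
  intro ε hε hεε₀
  obtain ⟨⟨h1, h2⟩, h3⟩ := hall ⟨hε, hεε₀⟩
  obtain ⟨hwc, ⟨hwC2, hweq⟩, -, -⟩ := huε ε hε
  have hεK : ε * (n * (K / lam)) ≤ ε ^ ((1 + q) / 2) := by
    have e1 : ε = ε ^ ((1 + q) / 2) * ε ^ ((1 - q) / 2) := by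
      rw [← Real.rpow_add hε]; ring_nf; exact (Real.rpow_one ε).symm
    have e2 : 0 < ε ^ ((1 + q) / 2) := Real.rpow_pos_of_pos hε _
    calc ε * (n * (K / lam)) = ε ^ ((1 + q) / 2) * (ε ^ ((1 - q) / 2) * (n * (K / lam))) := by
          rw [← mul_assoc (ε ^ ((1 + q) / 2)), ← e1]
      _ ≤ ε ^ ((1 + q) / 2) * 1 := by gcongr
      _ = _ := mul_one _
  have hexp : 1 - (1 - q) / 2 = (1 + q) / 2 := by ring
  rw [hα, hexp]
  have hint : ∀ x ∈ Ω, uε ε x - u x ≤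
      (1 / lam + 2 ^ (1 - q) / (1 - q)) * ε ^ ((1 + q) / 2) := by
    intro x hx
    have hDx : 0 < Metric.infDist x Ωᶜ := by
      have hcl : IsClosed Ωᶜ := hΩo.isClosed_compl
      have hnon : Ωᶜ.Nonempty := nonempty_compl.2 hne
      exact (hcl.notMem_iff_infDist_pos hnon).1 (fun h => h hx)
    have key := compare_eta Ω hΩo hΩb hne p q lam K L r ε (min (√ε) (Metric.infDist x Ωᶜ)) hq0 hq1
      hlam hK hr hε (lt_min (Real.sqrt_pos.2 hε) hDx) (min_le_left _ _) h2.le hd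
      (Ω.indicator u) (Ω.indicator f) f (uε ε) (fun y hy => indicator_of_mem hy f) hU0 hUc hUL hsc hfD
      hsub hsup hwC2 hweq h1 hεK x (min_le_right _ _)
    rwa [indicator_of_mem hx] at key
  intro x hx
  have := closure_minimal (s := Ω) (t := {x ∈ closure Ω | uε ε x - u x ≤
      (1 / lam + 2 ^ (1 - q) / (1 - q)) * ε ^ ((1 + q) / 2)})
    (fun y hy => ⟨subset_closure hy, hint y hy⟩)
    (isClosed_closure.isClosed_le (hwc.sub hu_cont) continuousOn_const)
  exact (this hx).2
end
end

section
/- Let Ω ⊂ ℝⁿ be open and bounded with C² boundary, let p > 2, λ > 0, and let f ≡ C_f be a constant function. Let u^ε ∈ C²(Ω) ∩ C(cl(Ω)) be the maximal solution of the state-constraint problem for λu + |Du|^p − εΔu = C_f (a classical solution in Ω, a viscosity supersolution on cl(Ω), satisfying λu^ε ≥ C_f on Ω and liminf_{Ω∋x→x₀} (u^ε(x) − u^ε(x₀))/|x−x₀|^{α_p} < 0 for every x₀ ∈ ∂Ω). Then for all sufficiently small ε > 0 and all x ∈ cl(Ω): 0 ≤ u^ε(x) − C_f/λ ≤ (1/λ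 + 2^{α_p}/α_p)·ε^{1 − α_p/2}. -/
open Set Metric Filter Topology Bornology MeasureTheory NNReal ENNReal

noncomputable section

lemma exists_unit_dir {n : ℕ} (C : Set (EuclideanSpace ℝ (Fin n))) (hC : IsClosed C)
    (hCne : C.Nonempty) (y : EuclideanSpace ℝ (Fin n)) (hy : y ∉ C)
    (hd : DifferentiableAt ℝ (fun x => infDist x C) y) :
    ∃ e : EuclideanSpace ℝ (Fin n), ‖e‖ = 1 ∧
      HasDerivAt (fun t : ℝ => infDist (y + t • e) C) 1 0 := by
  obtain ⟨q, hq, hqd⟩ := hC.exists_infDist_eq_dist hCne y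
  have hne : y - q ≠ 0 := by
    intro h; rw [sub_eq_zero] at h; exact hy (h ▸ hq)
  have hpos : 0 < ‖y - q‖ := norm_pos_iff.mpr hne
  set r := ‖y - q‖ with hr
  have hqd' : infDist y C = r := by rw [hqd, dist_eq_norm]
  refine ⟨r⁻¹ • (y - q), ?_, ?_⟩
  · rw [norm_smul, norm_inv, Real.norm_eq_abs, abs_of_pos hpos, ← hr, inv_mul_cancel₀ hpos.ne']
  set e := r⁻¹ • (y - q) with he
  have hen : y - q = r • e := by rw [he, smul_smul, mul_inv_cancel₀ hpos.ne', one_smul]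
  have hen1 : ‖e‖ = 1 := by
    rw [he, norm_smul, norm_inv, Real.norm_eq_abs, abs_of_pos hpos, ← hr, inv_mul_cancel₀ hpos.ne']
  have hl : HasDerivAt (fun t : ℝ => y + t • e) e 0 := by
    simpa using ((hasDerivAt_id (0:ℝ)).smul_const e).const_add y
  have h1 : HasDerivAt (fun t : ℝ => infDist (y + t • e) C)
      (fderiv ℝ (fun x => infDist x C) y e) 0 := by
    have := HasFDerivAt.comp_hasDerivAt (x := (0:ℝ)) (f := fun t : ℝ => y + t • e)
      (l := fun x => infDist x C) (l' := fderiv ℝ (fun x => infDist x C) y) (f' := e)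
      (by simpa using hd.hasFDerivAt) hl
    exact this
  have hval : ∀ t ∈ Set.Ioc (-r) 0, infDist (y + t • e) C = r + t := by
    intro t ht
    apply le_antisymm
    · refine (infDist_le_dist_of_mem hq).trans ?_
      rw [dist_eq_norm]
      have : y + t • e - q = (r + t) • e := by
        rw [add_smul, ← hen]; abel
      rw [this, norm_smul, hen1, Real.norm_eq_abs, abs_of_pos (by linarith [ht.1]), mul_one]
    · have := infDist_le_infDist_add_dist (s := C) (x := y) (y := y + t • e)
      rw [hqd', dist_eq_norm] at this
      have h2 : ‖y - (y + t • e)‖ = -t := by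
        rw [show y - (y + t • e) = (-t) • e by rw [neg_smul]; abel, norm_smul, hen1, mul_one,
          Real.norm_eq_abs, abs_of_nonneg (by linarith [ht.2])]
      linarith
  have h2 : HasDerivWithinAt (fun t : ℝ => infDist (y + t • e) C) 1 (Set.Iic 0) 0 := by
    have h3 : HasDerivWithinAt (fun t : ℝ => r + t) 1 (Set.Iic 0) 0 :=
      ((hasDerivAt_id (0:ℝ)).const_add r).hasDerivWithinAt
    refine h3.congr_of_eventuallyEq ?_ (hval 0 ⟨by linarith, le_refl _⟩)
    have : Set.Ioc (-r) 0 ∈ 𝓝[Set.Iic 0] (0:ℝ) := Ioc_mem_nhdsLE (by linarith)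
    filter_upwards [this] with t ht using hval t ht
  have h3 := (uniqueDiffWithinAt_Iic (0:ℝ)).eq_deriv _ h1.hasDerivWithinAt h2
  rwa [h3] at h1

lemma infDist_compl_eq {n : ℕ} (Ω : Set (EuclideanSpace ℝ (Fin n))) (hΩo : IsOpen Ω)
    (hne : (Ωᶜ).Nonempty) (x : EuclideanSpace ℝ (Fin n)) (hx : x ∈ Ω) :
    infDist x Ωᶜ = infDist x (frontier Ω) := by
  obtain ⟨q, hq, hqd⟩ := hΩo.isClosed_compl.exists_infDist_eq_dist hne x
  have hqf : q ∈ frontier Ω := by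
    rw [hΩo.frontier_eq]
    refine ⟨?_, hq⟩
    have hqx : q ≠ x := by rintro rfl; exact hq hx
    have hb : ball x (dist x q) ⊆ Ω := by
      intro w hw
      by_contra hwn
      have := infDist_le_dist_of_mem (x := x) (s := Ωᶜ) hwn
      rw [mem_ball, dist_comm] at hw
      linarith
    apply closure_mono hb
    rw [closure_ball x (dist_pos.mpr hqx.symm).ne', mem_closedBall, dist_comm]
  apply le_antisymm
  · refine infDist_le_infDist_of_subset ?_ ⟨q, hqf⟩
    rw [hΩo.frontier_eq]; exact fun w hw => hw.2
  · rw [hqd]; exact infDist_le_dist_of_mem hqf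

lemma interior_ball {n : ℕ} (Ω : Set (EuclideanSpace ℝ (Fin n)))
    (hΩo : IsOpen Ω) (hΩb : IsBounded Ω) (hC2 : 0 < deltaOm Ω) :
    ∃ R > 0, ∀ x ∈ Ω, ∃ z, x ∈ closedBall z R ∧ closedBall z R ⊆ Ω := by
  have hS : ({δ : ℝ | 0 < δ ∧ δ < sSup (dBdry Ω '' Ω) ∧
    ContDiffOn ℝ 2 (dBdry Ω) {x ∈ Ω | dBdry Ω x ≤ δ}}).Nonempty := by
    by_contra h
    rw [Set.not_nonempty_iff_eq_empty] at h
    unfold deltaOm at hC2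
    rw [h] at hC2
    simp at hC2
  obtain ⟨δ, hδ, hδ2, hcd⟩ := hS
  have hne : (Ωᶜ).Nonempty := by
    by_contra h
    rw [Set.not_nonempty_iff_eq_empty, Set.compl_empty_iff] at h
    subst h
    simp [dBdry] at hδ2
    have : sSup ((fun x : EuclideanSpace ℝ (Fin n) => dBdry (univ) x) '' univ) ≤ 0 := by
      apply Real.sSup_nonpos
      rintro _ ⟨x, -, rfl⟩
      simp [dBdry]
    simp [dBdry] at this
    first
      | linarith
      | (have h3 : sSup (range (dBdry (univ : Set (EuclideanSpace ℝ (Fin n))))) ≤ 0 := by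
          apply Real.sSup_nonpos
          rintro _ ⟨x, rfl⟩
          simp [dBdry]
         linarith)
  set g : EuclideanSpace ℝ (Fin n) → ℝ := fun x => infDist x Ωᶜ with hg
  have hgc : Continuous g := continuous_infDist_pt _
  have hgball : ∀ y r, r < g y → closedBall y r ⊆ Ω := by
    intro y r hr w hw
    by_contra hwn
    have := infDist_le_dist_of_mem (x := y) (s := Ωᶜ) hwn
    rw [mem_closedBall, dist_comm] at hw
    simp only [hg] at hr
    linarith
  have hgpos : ∀ y, 0 < g y → y ∈ Ω := by
    intro y hy
    by_contra hwn
    have : infDist y Ωᶜ = 0 := infDist_zero_of_mem hwn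
    simp only [hg] at hy; linarith
  have hgpos' : ∀ y ∈ Ω, 0 < g y := by
    intro y hy
    exact (hΩo.isClosed_compl.notMem_iff_infDist_pos hne).mp (by simpa using hy)
  have hdiff : ∀ y, 0 < g y → g y < δ → DifferentiableAt ℝ g y := by
    intro y hy hyd
    have hev : ∀ᶠ w in 𝓝 y, w ∈ Ω ∧ g w < δ :=
      (show ∀ᶠ w in 𝓝 y, w ∈ Ω from hΩo.mem_nhds (hgpos y hy)).and ((hgc.tendsto y).eventually_lt_const hyd)
    have h1 : {x ∈ Ω | dBdry Ω x ≤ δ} ∈ 𝓝 y := by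
      filter_upwards [hev] with w hw
      refine ⟨hw.1, ?_⟩
      unfold dBdry
      rw [← infDist_compl_eq Ω hΩo hne w hw.1]
      exact hw.2.le
    have h2 : DifferentiableAt ℝ (dBdry Ω) y := (hcd.contDiffAt h1).differentiableAt (by norm_num)
    refine h2.congr_of_eventuallyEq ?_
    filter_upwards [hev] with w hw
    exact infDist_compl_eq Ω hΩo hne w hw.1
  refine ⟨δ / 2, by linarith, fun x hx => ?_⟩
  have ht := hgpos' x hx
  set R := δ / 2 with hR
  have hR0 : 0 < R := by linarith
  by_cases htR : R < g x
  · exact ⟨x, mem_closedBall_self hR0.le, hgball x R htR⟩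
  push Not at htR
  set η := g x / (2 * R) with hη
  have hη0 : 0 < η := by positivity
  have hη1 : η ≤ 1 / 2 := by rw [hη, div_le_iff₀ (by positivity)]; linarith
  have hηR : η * R = g x / 2 := by rw [hη]; field_simp
  obtain ⟨y, hyB, hymax⟩ := (isCompact_closedBall x R).exists_isMaxOn
    (nonempty_closedBall.mpr hR0.le)
    (f := fun y => g y - (1 - η) * dist y x) (by fun_prop)
  have hyx := hymax (mem_closedBall_self hR0.le)
  simp only [Set.mem_ofPred_eq, dist_self, mul_zero, sub_zero] at hyx
  have hyR : dist y x ≤ R := hyB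
  have hdn : 0 ≤ dist y x := dist_nonneg
  have hgy : 0 < g y := by nlinarith
  refine ⟨y, by rwa [mem_closedBall, dist_comm], hgball y R ?_⟩
  by_contra hcon
  push Not at hcon
  have hlt : dist y x < R := by
    rcases hyR.lt_or_eq with h | h
    · exact h
    · rw [h] at hyx; nlinarith
  obtain ⟨e, he, hde⟩ := exists_unit_dir Ωᶜ hΩo.isClosed_compl hne y (by simpa using hgpos y hgy)
    (hdiff y hgy (by linarith))
  have hF : HasDerivAt (fun t : ℝ => infDist (y + t • e) Ωᶜ - (1 - η) * t) (1 - (1 - η)) 0 := by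
    exact (hde.fun_sub ((hasDerivAt_id (0:ℝ)).const_mul (1 - η))).congr_deriv (by ring)
  -- one-sided max
  have hev : ∀ᶠ t in 𝓝[>] (0:ℝ), infDist (y + t • e) Ωᶜ - (1 - η) * t ≤ g y := by
    have h1 : Set.Ioo 0 (R - dist y x) ∈ 𝓝[>] (0:ℝ) := Ioo_mem_nhdsGT (by linarith)
    filter_upwards [h1] with t ht'
    have hd : dist (y + t • e) x ≤ dist y x + t := by
      refine (dist_triangle _ y _).trans ?_
      rw [dist_eq_norm, add_sub_cancel_left, norm_smul, he, mul_one, Real.norm_eq_abs,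
        abs_of_pos ht'.1]; linarith
    have := hymax (show y + t • e ∈ closedBall x R from by rw [mem_closedBall]; linarith [ht'.2])
    simp only [Set.mem_ofPred_eq] at this
    have h3 : g (y + t • e) = infDist (y + t • e) Ωᶜ := rfl
    nlinarith
  have hsl := hasDerivAt_iff_tendsto_slope.mp hF
  have hsl2 : Tendsto (slope (fun t : ℝ => infDist (y + t • e) Ωᶜ - (1 - η) * t) 0) (𝓝[>] 0)
      (𝓝 (1 - (1 - η))) := hsl.mono_left (nhdsWithin_mono _ (fun t ht => ne_of_gt ht))
  have : 1 - (1 - η) ≤ 0 := by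
    refine le_of_tendsto hsl2 ?_
    filter_upwards [hev, self_mem_nhdsWithin] with t h1 h2
    rw [slope_def_field]
    apply div_nonpos_of_nonpos_of_nonneg
    · simp only [zero_smul, add_zero, mul_zero, sub_zero]
      simp only [hg] at h1; linarith
    · simpa using (le_of_lt h2)
  linarith


lemma barrier_alg (p α : ℝ) (hp : 2 < p) (hα : α = (p - 2) / (p - 1)) :
    ∃ g0 > 0, ∀ h ∈ Set.Icc (0:ℝ) 2,
      (1 - α) * (1 - h ^ 2 / 4) ^ 2 - (1 - h ^ 2 / 4) ^ p + h ^ 2 * (1 - h ^ 2 / 4) / 2 + g0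
        ≤ h ^ (2 - α) := by
  have hp1 : 0 < p - 1 := by linarith
  have hα0 : 0 < α := by rw [hα]; apply div_pos <;> linarith
  have hα1 : α < 1 := by rw [hα, div_lt_one hp1]; linarith
  set G : ℝ → ℝ := fun h => h ^ (2 - α) - ((1 - α) * (1 - h ^ 2 / 4) ^ 2 - (1 - h ^ 2 / 4) ^ p
    + h ^ 2 * (1 - h ^ 2 / 4) / 2) with hG
  have hGc : ContinuousOn G (Set.Icc 0 2) := by
    apply Continuous.continuousOn
    have h1 : Continuous fun h : ℝ => h ^ (2 - α) :=
      continuous_id.rpow_const (fun x => Or.inr (by linarith))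
    have h2 : Continuous fun h : ℝ => (1 - h ^ 2 / 4) ^ p :=
      Continuous.rpow_const (by fun_prop) (fun x => Or.inr (by linarith))
    simp only [hG]
    fun_prop
  have key : ∀ y ∈ Set.Icc (0:ℝ) 1, y ^ 2 * y ≤ α * y ^ 2 + y ^ p := by
    intro y hy
    rcases hy.1.eq_or_lt with h | h
    · rw [← h, Real.zero_rpow (by linarith)]; simp
    have hsplit : y ^ p = y ^ 2 * y ^ (p - 2) := by
      rw [← Real.rpow_natCast, ← Real.rpow_add h]; congr 1; push_cast; ring
    have : y ≤ α + y ^ (p - 2) := by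
      rcases le_total (p - 2) 1 with hb | hb
      · have := Real.rpow_le_rpow_of_exponent_ge h hy.2 hb
        rw [Real.rpow_one] at this; linarith
      · have hB := one_add_mul_self_le_rpow_one_add (s := y - 1) (by linarith) hb
        rw [show 1 + (y - 1) = y by ring] at hB
        have hnn : 0 ≤ y ^ (p - 2) := Real.rpow_nonneg hy.1 _
        by_cases hya : y ≤ α
        · linarith
        · push Not at hya
          have h1 : 1 - α = 1 / (p - 1) := by rw [hα]; field_simp; ring
          have h2 : (p - 2) * (1 - α) = α := by rw [h1, hα]; field_simp
          -- 1 - y < 1 - α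
          nlinarith
    rw [hsplit]; nlinarith [sq_nonneg y]
  have hGpos : ∀ h ∈ Set.Icc (0:ℝ) 2, 0 < G h := by
    intro h hh
    rcases hh.1.eq_or_lt with h0 | h0
    · simp only [hG, ← h0]
      rw [Real.zero_rpow (by linarith)]
      norm_num; linarith
    have hy : 1 - h ^ 2 / 4 ∈ Set.Icc (0:ℝ) 1 := ⟨by nlinarith [hh.2], by nlinarith⟩
    have hk := key _ hy
    simp only [hG]
    set y := 1 - h ^ 2 / 4 with hyd
    have hh2 : h ^ 2 = 4 * (1 - y) := by rw [hyd]; ring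
    rcases le_total h 1 with h1 | h1
    · have : h ^ (2:ℝ) ≤ h ^ (2 - α) := Real.rpow_le_rpow_of_exponent_ge h0 h1 (by linarith)
      rw [Real.rpow_two] at this
      have hy1 : y < 1 := by nlinarith
      have : y ^ 2 * (1 - y) ≤ 1 * (1 - y) := by
        apply mul_le_mul_of_nonneg_right _ (by linarith)
        nlinarith [hy.1, hy.2]
      rw [hh2] at *
      nlinarith [hy.1, hy.2]
    · have : 1 ≤ h ^ (2 - α) := Real.one_le_rpow h1 (by linarith)
      rw [hh2]
      have hy2 : y ≤ 3 / 4 := by nlinarith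
      nlinarith [hy.1, hy.2, mul_nonneg hy.1 (sub_nonneg.2 hy2), sq_nonneg (y - 1/2), mul_nonneg (mul_nonneg hy.1 (sub_nonneg.2 hy2)) hy.1]
  obtain ⟨h0, hh0, hmin⟩ := isCompact_Icc.exists_isMinOn (⟨0, by norm_num⟩ : (Set.Icc (0:ℝ) 2).Nonempty) hGc
  refine ⟨G h0, hGpos h0 hh0, fun h hh => ?_⟩
  have := hmin hh
  simp only [Set.mem_ofPred_eq] at this
  have h3 : G h = h ^ (2 - α) - ((1 - α) * (1 - h ^ 2 / 4) ^ 2 - (1 - h ^ 2 / 4) ^ p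
    + h ^ 2 * (1 - h ^ 2 / 4) / 2) := rfl
  linarith

def hh (s : ℝ) : ℝ := 2 - 4 / (Real.exp s + 1)

lemma hh_zero : hh 0 = 0 := by norm_num [hh]

lemma hh_lt (s : ℝ) : hh s < 2 := by
  have : 0 < 4 / (Real.exp s + 1) := by positivity
  unfold hh; linarith

lemma hh_deriv (s : ℝ) : HasDerivAt hh (1 - hh s ^ 2 / 4) s := by
  have h1 : Real.exp s + 1 ≠ 0 := by positivity
  have := (((Real.hasDerivAt_exp s).add_const 1).inv h1).const_mul 4 |>.const_sub 2
  unfold hh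
  refine this.congr_deriv ?_
  field_simp
  ring

lemma hh_cont : Continuous hh := by
  rw [continuous_iff_continuousAt]; exact fun s => (hh_deriv s).continuousAt

lemma hh_nonneg {s : ℝ} (hs : 0 ≤ s) : 0 ≤ hh s := by
  unfold hh
  have h1 : 1 ≤ Real.exp s := Real.one_le_exp hs
  have : 4 / (Real.exp s + 1) ≤ 2 := by rw [div_le_iff₀ (by positivity)]; linarith
  linarith

lemma hh_pos {s : ℝ} (hs : 0 < s) : 0 < hh s := by
  unfold hh
  have h1 : 1 < Real.exp s := Real.one_lt_exp_iff.mpr hs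
  have : 4 / (Real.exp s + 1) < 2 := by rw [div_lt_iff₀ (by positivity)]; linarith
  linarith

lemma hh_lower {s : ℝ} (hs : 0 ≤ s) (hs1 : s ≤ 1) : s / 2 ≤ hh s := by
  unfold hh
  have h1 : s + 1 ≤ Real.exp s := Real.add_one_le_exp s
  have : 4 / (Real.exp s + 1) ≤ 4 / (s + 2) := by
    apply div_le_div_of_nonneg_left <;> linarith
  have h2 : 4 / (s + 2) ≤ 2 - s / 2 := by rw [div_le_iff₀ (by positivity)]; nlinarith
  linarith

lemma hh_decay {s : ℝ} (hs : 0 ≤ s) : s * (1 - hh s ^ 2 / 4) ≤ 4 := by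
  have h1 : s + 1 ≤ Real.exp s := Real.add_one_le_exp s
  have h2 : 1 - hh s ^ 2 / 4 = 4 * Real.exp s / (Real.exp s + 1) ^ 2 := by
    unfold hh
    have h1 : Real.exp s + 1 ≠ 0 := by positivity
    field_simp
    ring
  rw [h2, mul_div_assoc', div_le_iff₀ (by positivity)]
  nlinarith [Real.exp_pos s]

/-- second order necessary condition -/
lemma second_order (F F' : ℝ → ℝ) (F2 : ℝ) (h1 : ∀ᶠ t in 𝓝 0, HasDerivAt F (F' t) t)
    (h2 : HasDerivAt F' F2 0) (hm : IsLocalMax F 0) : F' 0 = 0 ∧ F2 ≤ 0 := by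
  have h0 : F' 0 = 0 := hm.hasDerivAt_eq_zero h1.self_of_nhds
  refine ⟨h0, ?_⟩
  by_contra hc
  push Not at hc
  have hde : deriv F =ᶠ[𝓝 0] F' := h1.mono fun t ht => ht.deriv
  have hdd : deriv (deriv F) 0 = F2 := by rw [hde.deriv_eq]; exact h2.deriv
  have hmin : IsLocalMin F 0 := isLocalMin_of_deriv_deriv_pos (by rw [hdd]; exact hc)
    (by rw [hde.self_of_nhds, h0]) h1.self_of_nhds.continuousAt
  have hconst : F =ᶠ[𝓝 0] fun _ => F 0 := by
    filter_upwards [hm, hmin] with t a b using le_antisymm a b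
  have h5 : deriv F =ᶠ[𝓝 0] fun _ => 0 := by
    filter_upwards [hconst.deriv] with t ht
    rw [ht]; simp
  have : deriv (deriv F) 0 = 0 := by rw [h5.deriv_eq]; simp
  linarith

lemma hpow_deriv (α s : ℝ) (hs : 0 < s) :
    HasDerivAt (fun s => hh s ^ α) (α * hh s ^ (α - 1) * (1 - hh s ^ 2 / 4)) s := by
  have := (hh_deriv s).rpow_const (p := α) (Or.inl (hh_pos hs).ne')
  convert this using 1; ring

lemma hpow_deriv2 (α s : ℝ) (hs : 0 < s) :
    HasDerivAt (fun s => α * hh s ^ (α - 1) * (1 - hh s ^ 2 / 4))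
      (-(α * hh s ^ (α - 2) * ((1 - α) * (1 - hh s ^ 2 / 4) ^ 2
        + hh s ^ 2 * (1 - hh s ^ 2 / 4) / 2))) s := by
  have h1 := (hpow_deriv (α - 1) s hs).const_mul α
  have h2 := (((hh_deriv s).pow 2).div_const 4).const_sub 1
  have h3 := h1.mul h2
  have e1 : hh s ^ (α - 1) = hh s ^ (α - 2) * hh s := by
    rw [← Real.rpow_add_one (hh_pos hs).ne']; congr 1; ring
  refine h3.congr_deriv ?_
  simp only [Pi.pow_apply]
  rw [show α - 1 - 1 = α - 2 by ring, e1]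
  push_cast
  ring


lemma final_alg (n : ℕ) (p α σ R g0 s m : ℝ) (hp : 2 < p) (hα : α = (p - 2) / (p - 1))
    (hσ : 0 < σ) (hR : 0 < R) (hs : 0 < s) (hm0 : 0 ≤ m) (hm : m ^ 2 = 1 - 2 * σ * s / R)
    (hg0 : ∀ h ∈ Set.Icc (0:ℝ) 2,
      (1 - α) * (1 - h ^ 2 / 4) ^ 2 - (1 - h ^ 2 / 4) ^ p + h ^ 2 * (1 - h ^ 2 / 4) / 2 + g0
        ≤ h ^ (2 - α))
    (hsm : σ * (4 * p + 2 * n) / R ≤ g0) (y : ℝ) (hy : y = 1 - hh s ^ 2 / 4) :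
    σ ^ (2 - α) * (n * σ / R * (hh s ^ (α - 1) * y) +
      m ^ 2 * (hh s ^ (α - 2) * ((1 - α) * y ^ 2 + hh s ^ 2 * y / 2)))
      - (σ ^ (1 - α) * (hh s ^ (α - 1) * y) * m) ^ p ≤ σ ^ (2 - α) := by
  have hp1 : 0 < p - 1 := by linarith
  have hα0 : 0 < α := by rw [hα]; apply div_pos <;> linarith
  have hα1 : α < 1 := by rw [hα, div_lt_one hp1]; linarith
  have hαp : (1 - α) * p = 2 - α := by rw [hα]; field_simp; ring
  have h0 := hh_pos hs
  have h2 := hh_lt s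
  have hyd := hh_decay hs.le
  rw [← hy] at hyd
  have hb := hg0 (hh s) ⟨h0.le, h2.le⟩
  rw [← hy] at hb
  have hy0 : 0 < y := by rw [hy]; nlinarith
  have hy1 : y ≤ 1 := by rw [hy]; nlinarith
  set h := hh s
  have e1 : h ^ (α - 1) = h ^ (α - 2) * h := by
    rw [← Real.rpow_add_one h0.ne']; congr 1; ring
  have e2 : (σ ^ (1 - α) * (h ^ (α - 1) * y) * m) ^ p
      = σ ^ (2 - α) * (h ^ (α - 2) * (y ^ p * m ^ p)) := by
    rw [Real.mul_rpow (by positivity) hm0, Real.mul_rpow (by positivity) (by positivity),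
      Real.mul_rpow (by positivity) hy0.le, ← Real.rpow_mul hσ.le, ← Real.rpow_mul h0.le, hαp,
      show (α - 1) * p = α - 2 by linarith]
    ring
  rw [e2]
  have hm1 : m ^ 2 ≤ 1 := by rw [hm]; have : 0 < 2 * σ * s / R := by positivity
                             linarith
  have hmp : 1 - p * σ * s / R ≤ m ^ p := by
    have hB := one_add_mul_self_le_rpow_one_add (s := m ^ 2 - 1) (by nlinarith)
      (show 1 ≤ p / 2 by linarith)
    rw [show 1 + (m ^ 2 - 1) = m ^ 2 by ring, ← Real.rpow_natCast, ← Real.rpow_mul hm0] at hB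
    rw [show ((2:ℕ):ℝ) * (p / 2) = p by push_cast; ring] at hB
    rw [Real.rpow_natCast, hm] at hB
    refine le_trans (le_of_eq ?_) hB
    field_simp; ring
  have hyp : 0 < y ^ p := Real.rpow_pos_of_pos hy0 _
  have hypy : y ^ p ≤ y := by
    have := Real.rpow_le_rpow_of_exponent_ge hy0 hy1 (show 1 ≤ p by linarith)
    rwa [Real.rpow_one] at this
  have t1 : y ^ p - 4 * p * σ / R ≤ y ^ p * m ^ p := by
    have a1 : y ^ p * (1 - p * σ * s / R) ≤ y ^ p * m ^ p := mul_le_mul_of_nonneg_left hmp hyp.le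
    have a2 : y ^ p * s ≤ 4 := le_trans (by nlinarith) hyd
    have a3 : (y ^ p * s) * (p * σ / R) ≤ 4 * (p * σ / R) :=
      mul_le_mul_of_nonneg_right a2 (by positivity)
    have a4 : y ^ p * (1 - p * σ * s / R) = y ^ p - (y ^ p * s) * (p * σ / R) := by ring
    have a5 : 4 * p * σ / R = 4 * (p * σ / R) := by ring
    linarith
  have t2 : n * σ / R * (h * y) ≤ 2 * n * σ / R := by
    have : h * y ≤ 2 := by nlinarith
    have a3 : (n * σ / R) * (h * y) ≤ (n * σ / R) * 2 :=
      mul_le_mul_of_nonneg_left this (by positivity)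
    linarith [show 2 * n * σ / R = (n * σ / R) * 2 by ring]
  have t3 : m ^ 2 * ((1 - α) * y ^ 2 + h ^ 2 * y / 2) ≤ (1 - α) * y ^ 2 + h ^ 2 * y / 2 := by
    have : 0 ≤ (1 - α) * y ^ 2 + h ^ 2 * y / 2 := by
      have : 0 < 1 - α := by linarith
      positivity
    nlinarith
  have t4 : σ * (4 * p + 2 * n) / R = 4 * p * σ / R + 2 * n * σ / R := by ring
  have tot : n * σ / R * (h * y) + m ^ 2 * ((1 - α) * y ^ 2 + h ^ 2 * y / 2) - y ^ p * m ^ p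
      ≤ h ^ (2 - α) := by linarith
  have hpos : 0 < h ^ (α - 2) := Real.rpow_pos_of_pos h0 _
  have hinv : h ^ (α - 2) * h ^ (2 - α) = 1 := by
    rw [← Real.rpow_add h0]; simp
  have t5 := mul_le_mul_of_nonneg_left tot hpos.le
  rw [hinv] at t5
  have hPp : 0 < σ ^ (2 - α) := Real.rpow_pos_of_pos hσ _
  have t6 := mul_le_mul_of_nonneg_left t5 hPp.le
  rw [mul_one] at t6
  refine le_trans (le_of_eq ?_) t6
  rw [e1]; ring

lemma line_deriv {n : ℕ} (Ω : Set (EuclideanSpace ℝ (Fin n))) (hΩo : IsOpen Ω)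
    (u : EuclideanSpace ℝ (Fin n) → ℝ) (hu : ContDiffOn ℝ 2 u Ω)
    (x e : EuclideanSpace ℝ (Fin n)) (hx : x ∈ Ω) :
    (∀ᶠ t in 𝓝 (0:ℝ), HasDerivAt (fun t : ℝ => u (x + t • e)) (fderiv ℝ u (x + t • e) e) t) ∧
    HasDerivAt (fun t : ℝ => fderiv ℝ u (x + t • e) e) (fderiv ℝ (fderiv ℝ u) x e e) 0 := by
  have hl : ∀ t : ℝ, HasDerivAt (fun t : ℝ => x + t • e) e t := by
    intro t
    simpa using ((hasDerivAt_id t).smul_const e).const_add x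
  constructor
  · have hc : ContinuousAt (fun t : ℝ => x + t • e) 0 := (hl 0).continuousAt
    have : ∀ᶠ t in 𝓝 (0:ℝ), x + t • e ∈ Ω := hc.eventually_mem (by simpa using hΩo.mem_nhds hx)
    filter_upwards [this] with t ht
    have hd : DifferentiableAt ℝ u (x + t • e) :=
      (hu.contDiffAt (hΩo.mem_nhds ht)).differentiableAt (by norm_num)
    exact hd.hasFDerivAt.comp_hasDerivAt t (hl t)
  · have h1 : ContDiffAt ℝ 1 (fderiv ℝ u) x :=
      (hu.contDiffAt (hΩo.mem_nhds hx)).fderiv_right (by norm_num)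
    have hd : HasFDerivAt (fderiv ℝ u) (fderiv ℝ (fderiv ℝ u) x) (x + (0:ℝ) • e) := by
      simpa using (h1.differentiableAt (by norm_num)).hasFDerivAt
    have := hd.comp_hasDerivAt (0:ℝ) (hl 0)
    have h3 := this.clm_apply (hasDerivAt_const (0:ℝ) e)
    simpa using h3

lemma barrier_line (α A σ R q0 a : ℝ) (hσ : 0 < σ) (hR : 0 < R) (hq : 0 < q0) :
    (∀ᶠ t in 𝓝 (0:ℝ), HasDerivAt (fun t : ℝ => -A * hh ((q0 - (2 * t * a + t ^ 2) / (2 * R)) / σ) ^ α)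
      (A / (R * σ) * ((a + t) * (α * hh ((q0 - (2 * t * a + t ^ 2) / (2 * R)) / σ) ^ (α - 1) *
        (1 - hh ((q0 - (2 * t * a + t ^ 2) / (2 * R)) / σ) ^ 2 / 4)))) t) ∧
    HasDerivAt (fun t : ℝ => A / (R * σ) * ((a + t) * (α * hh ((q0 - (2 * t * a + t ^ 2) / (2 * R)) / σ) ^ (α - 1) *
        (1 - hh ((q0 - (2 * t * a + t ^ 2) / (2 * R)) / σ) ^ 2 / 4))))
      (A / (R * σ) * (α * hh (q0 / σ) ^ (α - 1) * (1 - hh (q0 / σ) ^ 2 / 4) +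
       a ^ 2 / (R * σ) * (α * hh (q0 / σ) ^ (α - 2) * ((1 - α) * (1 - hh (q0 / σ) ^ 2 / 4) ^ 2
        + hh (q0 / σ) ^ 2 * (1 - hh (q0 / σ) ^ 2 / 4) / 2)))) 0 := by
  have hQ : ∀ t : ℝ, HasDerivAt (fun t : ℝ => (q0 - (2 * t * a + t ^ 2) / (2 * R)) / σ)
      (-((a + t) / (R * σ))) t := by
    intro t
    have h1 : HasDerivAt (fun t : ℝ => 2 * t * a + t ^ 2) (2 * a + 2 * t) t := by
      have := (((hasDerivAt_id t).const_mul 2).mul_const a).fun_add ((hasDerivAt_id t).fun_pow 2)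
      exact this.congr_deriv (by simp)
    refine (((h1.div_const (2 * R)).const_sub q0).div_const σ).congr_deriv ?_
    field_simp
  have hev : ∀ᶠ t in 𝓝 (0:ℝ), 0 < (q0 - (2 * t * a + t ^ 2) / (2 * R)) / σ := by
    refine (hQ 0).continuousAt.eventually_const_lt ?_
    simp; positivity
  constructor
  · filter_upwards [hev] with t ht
    have := ((hpow_deriv α _ ht).comp t (hQ t)).const_mul (-A)
    refine this.congr_deriv ?_
    field_simp
  · have h0 := hev.self_of_nhds
    have h1 := (hpow_deriv2 α _ h0).comp (0:ℝ) (hQ 0)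
    have h2 := ((hasDerivAt_id (0:ℝ)).const_add a).fun_mul h1
    have h3 := h2.const_mul (A / (R * σ))
    refine h3.congr_deriv ?_
    simp
    left
    ring


set_option maxHeartbeats 1000000 in
lemma ball_est {n : ℕ} (Ω : Set (EuclideanSpace ℝ (Fin n))) (hΩo : IsOpen Ω)
    (u : EuclideanSpace ℝ (Fin n) → ℝ) (hu : ContDiffOn ℝ 2 u Ω)
    (p α σ R g0 lam Cf : ℝ) (hp : 2 < p) (hα : α = (p - 2) / (p - 1))
    (hlam : 0 < lam) (hσ : 0 < σ) (hR : 0 < R)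
    (hg0 : ∀ h ∈ Set.Icc (0:ℝ) 2,
      (1 - α) * (1 - h ^ 2 / 4) ^ 2 - (1 - h ^ 2 / 4) ^ p + h ^ 2 * (1 - h ^ 2 / 4) / 2 + g0
        ≤ h ^ (2 - α))
    (hsm : σ * (4 * p + 2 * n) / R ≤ g0)
    (heq : ∀ x ∈ Ω, lam * u x + ‖gradient u x‖ ^ p - σ ^ 2 * lapl u x = Cf)
    (z : EuclideanSpace ℝ (Fin n)) (hz : closedBall z R ⊆ Ω) :
    ∀ x ∈ closedBall z R, u x - Cf / lam ≤ (1 / lam + 2 ^ α / α) * σ ^ (2 - α) := by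
  have hp1 : 0 < p - 1 := by linarith
  have hα0 : 0 < α := by rw [hα]; apply div_pos <;> linarith
  have hα1 : α < 1 := by rw [hα, div_lt_one hp1]; linarith
  set P := σ ^ (2 - α) with hP
  have hP0 : 0 < P := Real.rpow_pos_of_pos hσ _
  set A := P / α with hA
  have hA0 : 0 < A := by positivity
  set q : EuclideanSpace ℝ (Fin n) → ℝ := fun x => (R ^ 2 - ‖x - z‖ ^ 2) / (2 * R) with hq
  have hqc : Continuous q := by simp only [hq]; fun_prop
  set w : EuclideanSpace ℝ (Fin n) → ℝ := fun x => -A * hh (q x / σ) ^ α with hw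
  have hwc : Continuous w := by
    have : Continuous fun x => hh (q x / σ) ^ α :=
      (hh_cont.comp (hqc.div_const σ)).rpow_const (fun x => Or.inr hα0.le)
    simp only [hw]; fun_prop
  have hqnn : ∀ x ∈ closedBall z R, 0 ≤ q x := by
    intro x hx
    rw [mem_closedBall, dist_eq_norm] at hx
    simp only [hq]
    apply div_nonneg _ (by linarith)
    nlinarith [norm_nonneg (x - z)]
  obtain ⟨x0, hx0B, hmax⟩ := (isCompact_closedBall z R).exists_isMaxOn
    (nonempty_closedBall.mpr hR.le) (f := fun x => u x - w x)
    ((hu.continuousOn.mono hz).sub hwc.continuousOn)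
  have hx0Ω := hz hx0B
  have hx0R : ‖x0 - z‖ ≤ R := by rwa [mem_closedBall, dist_eq_norm] at hx0B
  -- the maximum is not attained on the sphere
  have hint : ‖x0 - z‖ < R := by
    rcases hx0R.lt_or_eq with h | h
    · exact h
    exfalso
    obtain ⟨hd, -⟩ := line_deriv Ω hΩo u hu x0 (z - x0) hx0Ω
    have hd0 := hd.self_of_nhds
    set L := fderiv ℝ u (x0 + (0:ℝ) • (z - x0)) (z - x0)
    have hsl := (hasDerivAt_iff_tendsto_slope.mp hd0).mono_left
      (nhdsWithin_mono (0:ℝ) (fun t (ht : t ∈ Set.Ioi (0:ℝ)) => ne_of_gt ht))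
    have hbd : ∀ᶠ t in 𝓝[>] (0:ℝ), L - 1 < slope (fun t : ℝ => u (x0 + t • (z - x0))) 0 t :=
      hsl.eventually_const_lt (by linarith)
    have hbig := (tendsto_rpow_neg_nhdsGT_zero (y := α - 1) (by linarith)).eventually_gt_atTop
      ((1 - L) / (A * (R / (4 * σ)) ^ α))
    have hsmall : Set.Ioo 0 (min 1 (σ / R)) ∈ 𝓝[>] (0:ℝ) := Ioo_mem_nhdsGT (by positivity)
    obtain ⟨t, h1, h2, h3⟩ := (hbd.and (hbig.and hsmall)).exists
    have ht0 := h3.1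
    have ht1 : t < 1 := lt_of_lt_of_le h3.2 (min_le_left _ _)
    have htσ : t < σ / R := lt_of_lt_of_le h3.2 (min_le_right _ _)
    rw [slope_def_field, lt_div_iff₀ (by linarith)] at h1
    simp only [zero_smul, add_zero, sub_zero] at h1
    have hxt : x0 + t • (z - x0) - z = (1 - t) • (x0 - z) := by
      rw [sub_smul, one_smul, smul_sub, smul_sub]; abel
    have hnt : ‖x0 + t • (z - x0) - z‖ = (1 - t) * R := by
      rw [hxt, norm_smul, h, Real.norm_eq_abs, abs_of_pos (by linarith)]
    have hm := hmax (show x0 + t • (z - x0) ∈ closedBall z R by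
      rw [mem_closedBall, dist_eq_norm, hnt]; nlinarith)
    simp only [Set.mem_ofPred_eq] at hm
    have hw0 : w x0 = 0 := by
      simp only [hw, hq, h, sub_self, zero_div, hh_zero, Real.zero_rpow hα0.ne', mul_zero]
    have hqt : q (x0 + t • (z - x0)) / σ = R * t * (2 - t) / (2 * σ) := by
      simp only [hq, hnt]; field_simp; ring
    have hrt : R * t / (2 * σ) ≤ q (x0 + t • (z - x0)) / σ := by
      rw [hqt]
      apply div_le_div_of_nonneg_right _ (by positivity)
      nlinarith [mul_pos hR ht0]
    have hrt1 : R * t / (2 * σ) ≤ 1 := by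
      rw [lt_div_iff₀ hR] at htσ
      rw [div_le_one (by positivity)]; linarith
    have hmono : StrictMono hh := by
      intro a b hab
      unfold hh
      have := Real.exp_lt_exp.mpr hab
      have : 4 / (Real.exp b + 1) < 4 / (Real.exp a + 1) := by
        apply div_lt_div_of_pos_left <;> first | positivity | linarith
      linarith
    have hlow : R / (4 * σ) * t ≤ hh (q (x0 + t • (z - x0)) / σ) := by
      refine le_trans ?_ (hmono.monotone hrt)
      refine le_trans (le_of_eq ?_) (hh_lower (by positivity) hrt1)
      field_simp; ring
    have hlow2 : (R / (4 * σ)) ^ α * t ^ α ≤ hh (q (x0 + t • (z - x0)) / σ) ^ α := by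
      rw [← Real.mul_rpow (by positivity) ht0.le]
      exact Real.rpow_le_rpow (by positivity) hlow hα0.le
    have hlow3 : A * ((R / (4 * σ)) ^ α * t ^ α) ≤ -w (x0 + t • (z - x0)) := by
      simp only [hw]
      have := mul_le_mul_of_nonneg_left hlow2 hA0.le
      linarith
    have hta : t ^ α = t ^ (α - 1) * t := by
      rw [← Real.rpow_add_one ht0.ne']; congr 1; ring
    rw [div_lt_iff₀ (by positivity)] at h2
    have h4 := mul_lt_mul_of_pos_right h2 ht0
    rw [hta] at hlow3
    rw [hw0] at hm
    linarith
  have hq0 : 0 < q x0 := by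
    simp only [hq]
    apply div_pos _ (by linarith)
    nlinarith [norm_nonneg (x0 - z)]
  set s := q x0 / σ with hs
  have hs0 : 0 < s := by positivity
  set y := 1 - hh s ^ 2 / 4 with hy
  -- conditions at the interior maximum
  have hloc : IsLocalMax (fun x => u x - w x) x0 := by
    refine hmax.isLocalMax ?_
    refine mem_of_superset (isOpen_ball.mem_nhds ?_) ball_subset_closedBall
    rwa [mem_ball, dist_eq_norm]
  have hdir : ∀ i : Fin n,
      fderiv ℝ u x0 (EuclideanSpace.single i 1) = A / (R * σ) * ((x0 - z) i *
        (α * hh s ^ (α - 1) * y)) ∧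
      fderiv ℝ (fderiv ℝ u) x0 (EuclideanSpace.single i 1) (EuclideanSpace.single i 1) ≤
        A / (R * σ) * (α * hh s ^ (α - 1) * y + (x0 - z) i ^ 2 / (R * σ) *
          (α * hh s ^ (α - 2) * ((1 - α) * y ^ 2 + hh s ^ 2 * y / 2))) := by
    intro i
    set e : EuclideanSpace ℝ (Fin n) := EuclideanSpace.single i 1 with he
    obtain ⟨hd1, hd2⟩ := line_deriv Ω hΩo u hu x0 e hx0Ω
    obtain ⟨hb1, hb2⟩ := barrier_line α A σ R (q x0) ((x0 - z) i) hσ hR hq0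
    have hwl : ∀ t : ℝ, w (x0 + t • e) =
        -A * hh ((q x0 - (2 * t * (x0 - z) i + t ^ 2) / (2 * R)) / σ) ^ α := by
      intro t
      have hn : ‖x0 + t • e - z‖ ^ 2 = ‖x0 - z‖ ^ 2 + 2 * t * (x0 - z) i + t ^ 2 := by
        rw [show x0 + t • e - z = (x0 - z) + t • e by abel, norm_add_sq_real, inner_smul_right,
          norm_smul, he, EuclideanSpace.inner_single_right, EuclideanSpace.norm_single]
        simp
        ring
      have : q (x0 + t • e) = q x0 - (2 * t * (x0 - z) i + t ^ 2) / (2 * R) := by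
        simp only [hq]; rw [hn]; field_simp; ring
      simp only [hw, this]
    have hlm : IsLocalMax (fun t : ℝ => u (x0 + t • e) -
        -A * hh ((q x0 - (2 * t * (x0 - z) i + t ^ 2) / (2 * R)) / σ) ^ α) 0 := by
      have hc : ContinuousAt (fun t : ℝ => x0 + t • e) 0 := by fun_prop
      have ht : Tendsto (fun t : ℝ => x0 + t • e) (𝓝 0) (𝓝 x0) := by
        have := hc.tendsto; simpa using this
      have := ht.eventually hloc
      filter_upwards [this] with t ht
      rw [← hwl, ← hwl]
      simpa using ht
    obtain ⟨r1, r2⟩ := second_order _ _ _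
      (hd1.and hb1 |>.mono fun t ht => ht.1.fun_sub ht.2) (hd2.fun_sub hb2) hlm
    constructor
    · simp only [zero_smul, add_zero, mul_zero, zero_mul, ne_eq, OfNat.ofNat_ne_zero,
        not_false_eq_true, zero_pow, zero_div, sub_zero] at r1
      exact sub_eq_zero.mp r1
    · exact sub_nonpos.mp r2
  set B := σ ^ (1 - α) * (hh s ^ (α - 1) * y) with hBd
  have hh0 := hh_pos hs0
  have hh2 := hh_lt s
  have hy0 : 0 < y := by rw [hy]; nlinarith
  have hB0 : 0 < B := by positivity
  have hPσ : P = σ ^ (1 - α) * σ := by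
    rw [hP, ← Real.rpow_add_one hσ.ne']; congr 1; ring
  have hAB : A / (R * σ) * (α * hh s ^ (α - 1) * y) = B / R := by
    rw [hA, hPσ, hBd]; field_simp
  set m := ‖x0 - z‖ / R with hm
  have hgrad : ‖gradient u x0‖ = B * m := by
    have : gradient u x0 = (B / R) • (x0 - z) := by
      ext i
      have h1 : fderiv ℝ u x0 (EuclideanSpace.single i 1) = (gradient u x0) i := by
        rw [← inner_gradient_left, EuclideanSpace.inner_single_right]; simp
      rw [← h1, (hdir i).1, ← hAB]
      simp
      ring
    rw [this, norm_smul, Real.norm_eq_abs, abs_of_pos (by positivity), hm]; ring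
  have hlap : σ ^ 2 * lapl u x0 ≤ P * (n * σ / R * (hh s ^ (α - 1) * y) +
      m ^ 2 * (hh s ^ (α - 2) * ((1 - α) * y ^ 2 + hh s ^ 2 * y / 2))) := by
    have h1 : lapl u x0 ≤ ∑ i : Fin n, A / (R * σ) * (α * hh s ^ (α - 1) * y +
        (x0 - z) i ^ 2 / (R * σ) *
          (α * hh s ^ (α - 2) * ((1 - α) * y ^ 2 + hh s ^ 2 * y / 2))) :=
      Finset.sum_le_sum fun i _ => (hdir i).2
    rw [← Finset.mul_sum, Finset.sum_add_distrib, Finset.sum_const,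
      ← Finset.sum_mul, ← Finset.sum_div,
      ← EuclideanSpace.real_norm_sq_eq] at h1
    simp only [Finset.card_univ, Fintype.card_fin, nsmul_eq_mul] at h1
    have h2 := mul_le_mul_of_nonneg_left h1 (sq_nonneg σ)
    refine h2.trans (le_of_eq ?_)
    rw [hA, hm]
    field_simp
  have hfin := final_alg n p α σ R g0 s m hp hα hσ hR hs0 (by positivity)
    (by rw [hm, hs]; simp only [hq]; field_simp; ring) hg0 hsm y hy
  have hE := heq x0 hx0Ω
  rw [hgrad] at hE
  have hv : lam * u x0 - Cf ≤ P := by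
    simp only [← hP, ← hBd] at hfin
    linarith
  have hv2 : u x0 - Cf / lam ≤ P / lam := by
    rw [← sub_nonneg] at hv ⊢
    have : P / lam - (u x0 - Cf / lam) = (P - (lam * u x0 - Cf)) / lam := by field_simp
    rw [this]; positivity
  intro x hx
  have hmx := hmax hx
  simp only [Set.mem_ofPred_eq] at hmx
  have hwx : w x ≤ 0 := by
    have : 0 ≤ hh (q x / σ) ^ α :=
      Real.rpow_nonneg (hh_nonneg (div_nonneg (hqnn x hx) hσ.le)) _
    simp only [hw]
    have h2 := mul_nonneg hA0.le this
    linarith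
  have hw0 : -w x0 ≤ A * 2 ^ α := by
    have : hh (q x0 / σ) ^ α ≤ 2 ^ α := Real.rpow_le_rpow hh0.le hh2.le hα0.le
    simp only [hw]
    have h2 := mul_le_mul_of_nonneg_left this hA0.le
    linarith
  have : (1 / lam + 2 ^ α / α) * P = P / lam + A * 2 ^ α := by rw [hA]; ring
  rw [this]; linarith

/-- For constant data `f ≡ C_f`, the maximal state-constraint solution
`u^ε` satisfies `0 ≤ u^ε − C_f/λ ≤ (1/λ + 2^{α_p}/α_p)·ε^{1 − α_p/2}` on `cl Ω` for all
sufficiently small `ε > 0`, where `α_p = (p−2)/(p−1)`.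
The `C²`-boundary assumption is encoded by `0 < δ_Ω`. -/
theorem constant_data_estimate {n : ℕ} (Ω : Set (EuclideanSpace ℝ (Fin n)))
    (hΩo : IsOpen Ω) (hΩb : IsBounded Ω) (hΩne : Ω.Nonempty)
    (hC2 : 0 < deltaOm Ω)
    (p lam : ℝ) (hp : 2 < p) (hlam : 0 < lam)
    (Cf : ℝ)
    -- `uε ε` is the maximal solution of the state-constraint problem for
    -- `λu + |Du|^p − εΔu = C_f`
    (uε : ℝ → EuclideanSpace ℝ (Fin n) → ℝ)
    (huε : ∀ ε : ℝ, 0 < ε →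
      ContinuousOn (uε ε) (closure Ω) ∧
      ClassicalSolIn Ω lam p ε (fun _ => Cf) (uε ε) ∧
      ViscSupOn Ω lam p ε (fun _ => Cf) (uε ε) ∧
      (∀ x ∈ Ω, Cf ≤ lam * uε ε x) ∧
      BdryStrict Ω ((p - 2) / (p - 1)) (uε ε)) :
    ∃ ε₀ > (0:ℝ), ∀ ε : ℝ, 0 < ε → ε < ε₀ → ∀ x ∈ closure Ω,
      0 ≤ uε ε x - Cf / lam ∧
      uε ε x - Cf / lam ≤
        (1 / lam + (2 : ℝ) ^ ((p - 2) / (p - 1)) / ((p - 2) / (p - 1)))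
          * ε ^ (1 - ((p - 2) / (p - 1)) / 2) := by
  set α := (p - 2) / (p - 1) with hα
  obtain ⟨R, hR, hball⟩ := interior_ball Ω hΩo hΩb hC2
  obtain ⟨g0, hg0, hb⟩ := barrier_alg p α hp hα
  have hc : 0 < (4 * p + 2 * n) / R := by positivity
  refine ⟨(g0 / ((4 * p + 2 * n) / R)) ^ 2, by positivity, fun ε hε hε0 => ?_⟩
  obtain ⟨hcont, ⟨hcd, heq⟩, -, hlow, -⟩ := huε ε hε
  set σ := Real.sqrt ε with hσd
  have hσ : 0 < σ := Real.sqrt_pos.mpr hε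
  have hσ2 : σ ^ 2 = ε := Real.sq_sqrt hε.le
  have hσs : σ < g0 / ((4 * p + 2 * n) / R) := by
    rw [← hσ2] at hε0
    exact lt_of_pow_lt_pow_left₀ 2 (by positivity) hε0
  have hsm : σ * (4 * p + 2 * n) / R ≤ g0 := by
    rw [lt_div_iff₀ hc] at hσs
    rw [mul_div_assoc]; exact hσs.le
  have hεp : ε ^ (1 - α / 2) = σ ^ (2 - α) := by
    rw [← hσ2, ← Real.rpow_natCast, ← Real.rpow_mul hσ.le]; congr 1; push_cast; ring
  rw [hεp]
  have hup : ∀ x ∈ Ω, uε ε x - Cf / lam ≤ (1 / lam + 2 ^ α / α) * σ ^ (2 - α) := by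
    intro x hx
    obtain ⟨z, hxz, hz⟩ := hball x hx
    exact ball_est Ω hΩo (uε ε) hcd p α σ R g0 lam Cf hp hα hlam hσ hR hb hsm
      (by rw [hσ2]; exact heq) z hz x hxz
  have hlo : ∀ x ∈ Ω, 0 ≤ uε ε x - Cf / lam := by
    intro x hx
    have := hlow x hx
    rw [sub_nonneg, div_le_iff₀ hlam]; linarith
  have hcont2 : ContinuousOn (fun x => uε ε x - Cf / lam) (closure Ω) :=
    hcont.sub continuousOn_const
  intro x hx
  have hmem := hcont2.image_closure (mem_image_of_mem _ hx)
  have hsub : (fun x => uε ε x - Cf / lam) '' Ω ⊆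
      Set.Icc 0 ((1 / lam + 2 ^ α / α) * σ ^ (2 - α)) := by
    rintro _ ⟨x, hx, rfl⟩
    exact ⟨hlo x hx, hup x hx⟩
  exact closure_minimal hsub isClosed_Icc hmem
end
end
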